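/- arXiv:1902.08677 — 5 statements merged into one kernel-verified Lean document; each statement's English description precedes it below -/
import Mathlib

section
/- (Mazur) Let I be an ideal on ℕ containing all finite sets. The following are equivalent: (i) I is an Fσ subset of 2^ℕ; (ii) there is a hereditary collection K of subsets of ℕ which is closed as a subset of 2^ℕ such that I is the ideal generated by K, i.e., B ∈ I iff B ⊆ A₁ ∪ ⋯ ∪ Aₙ for some n and A₁,…,Aₙ ∈ K; (iii) there is a lower semicontinuous submeasure φ such that I = Fin(φ) = {A ⊆ ℕ : φ(A) < ∞}. -/
open Set Filter Topology ENNReal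

/-- An ideal on a set `X`. -/
def IsIdeal {X : Type*} (I : Set (Set X)) : Prop :=
  ∅ ∈ I ∧ (Set.univ : Set X) ∉ I ∧ (∀ A B : Set X, A ∈ I → B ∈ I → A ∪ B ∈ I) ∧
    ∀ A B : Set X, A ⊆ B → B ∈ I → A ∈ I

def ContainsFin {X : Type*} (I : Set (Set X)) : Prop := ∀ A : Set X, A.Finite → A ∈ I

noncomputable def chi (A : Set ℕ) : ℕ → Bool := fun n => @decide (n ∈ A) (Classical.propDecidable _)

/-- `Fσ` subset of a topological space: countable union of closed sets. -/
def IsFsigma {Y : Type*} [TopologicalSpace Y] (S : Set Y) : Prop :=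
  ∃ F : ℕ → Set Y, (∀ n, IsClosed (F n)) ∧ S = ⋃ n, F n

/-- Lower semicontinuous submeasure on `ℕ`. -/
def IsLSCSM (φ : Set ℕ → ℝ≥0∞) : Prop :=
  φ ∅ = 0 ∧ (∀ A B : Set ℕ, φ A ≤ φ (A ∪ B) ∧ φ (A ∪ B) ≤ φ A + φ B) ∧
    ∀ A : Set ℕ, Tendsto (fun n => φ (A ∩ {k | k ≤ n})) atTop (nhds (φ A))

/-- `Fin(φ) = {A : φ(A) < ∞}`. -/
def FinPhi (φ : Set ℕ → ℝ≥0∞) : Set (Set ℕ) := {A | φ A < ⊤}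

def Hereditary (K : Set (Set ℕ)) : Prop := ∀ A ∈ K, ∀ B ⊆ A, B ∈ K

theorem chi_apply (A : Set ℕ) (n : ℕ) : chi A n = true ↔ n ∈ A := by simp [chi]

theorem chi_set (f : ℕ → Bool) : chi {n | f n = true} = f := by
  funext n
  rw [Bool.eq_iff_iff, chi_apply]; rfl

theorem set_chi (A : Set ℕ) : {n | chi A n = true} = A := by
  ext n; exact chi_apply A n

theorem chi_inj : Function.Injective chi := by
  intro A B h
  rw [← set_chi A, h, set_chi]

theorem chi_image (C : Set (Set ℕ)) : chi '' C = {f | {n | f n = true} ∈ C} := by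
  ext f
  constructor
  · rintro ⟨A, hA, rfl⟩
    simpa [set_chi] using hA
  · intro h
    exact ⟨_, h, chi_set f⟩

theorem cl_union {C D : Set (Set ℕ)} (hC : IsClosed (chi '' C)) (hD : IsClosed (chi '' D)) :
    IsClosed (chi '' (Set.image2 (· ∪ ·) C D)) := by
  have hc := (hC.isCompact.prod hD.isCompact).image
    (f := fun p : (ℕ → Bool) × (ℕ → Bool) => fun n => (p.1 n || p.2 n))
    (continuous_pi fun n => by
      have h1 : Continuous (fun q : Bool × Bool => (q.1 || q.2)) :=
        continuous_of_discreteTopology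
      have h2 : Continuous (fun p : (ℕ → Bool) × (ℕ → Bool) => (p.1 n, p.2 n)) := by fun_prop
      exact h1.comp h2)
  convert hc.isClosed using 1
  have key : ∀ A B, chi (A ∪ B) = fun n => (chi A n || chi B n) := by
    intro A B; funext n
    rw [Bool.eq_iff_iff, chi_apply, Bool.or_eq_true, chi_apply, chi_apply]; rfl
  ext f
  constructor
  · rintro ⟨_, ⟨A, hA, B, hB, rfl⟩, rfl⟩
    exact ⟨(chi A, chi B), ⟨⟨A, hA, rfl⟩, ⟨B, hB, rfl⟩⟩, (key A B).symm⟩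
  · rintro ⟨⟨_, _⟩, ⟨⟨A, hA, rfl⟩, ⟨B, hB, rfl⟩⟩, rfl⟩
    exact ⟨A ∪ B, ⟨A, hA, B, hB, rfl⟩, key A B⟩

theorem cl_inter {C D : Set (Set ℕ)} (hC : IsClosed (chi '' C)) (hD : IsClosed (chi '' D)) :
    IsClosed (chi '' (Set.image2 (· ∩ ·) C D)) := by
  have hc := (hC.isCompact.prod hD.isCompact).image
    (f := fun p : (ℕ → Bool) × (ℕ → Bool) => fun n => (p.1 n && p.2 n))
    (continuous_pi fun n => by
      have h1 : Continuous (fun q : Bool × Bool => (q.1 && q.2)) :=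
        continuous_of_discreteTopology
      have h2 : Continuous (fun p : (ℕ → Bool) × (ℕ → Bool) => (p.1 n, p.2 n)) := by fun_prop
      exact h1.comp h2)
  convert hc.isClosed using 1
  have key : ∀ A B, chi (A ∩ B) = fun n => (chi A n && chi B n) := by
    intro A B; funext n
    rw [Bool.eq_iff_iff, chi_apply, Bool.and_eq_true, chi_apply, chi_apply]; rfl
  ext f
  constructor
  · rintro ⟨_, ⟨A, hA, B, hB, rfl⟩, rfl⟩
    exact ⟨(chi A, chi B), ⟨⟨A, hA, rfl⟩, ⟨B, hB, rfl⟩⟩, (key A B).symm⟩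
  · rintro ⟨⟨_, _⟩, ⟨⟨A, hA, rfl⟩, ⟨B, hB, rfl⟩⟩, rfl⟩
    exact ⟨A ∩ B, ⟨A, hA, B, hB, rfl⟩, key A B⟩

theorem cl_down {C : Set (Set ℕ)} (hC : IsClosed (chi '' C)) :
    IsClosed (chi '' {B | ∃ A ∈ C, B ⊆ A}) := by
  have hu : IsClosed (chi '' (Set.univ : Set (Set ℕ))) := by
    rw [chi_image]; simp
  convert cl_inter hC hu using 2
  ext B
  constructor
  · rintro ⟨A, hA, h⟩
    exact ⟨A, hA, B, trivial, Set.inter_eq_right.2 h⟩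
  · rintro ⟨A, hA, D, -, rfl⟩
    exact ⟨A, hA, Set.inter_subset_left⟩

theorem cl_empty : IsClosed (chi '' {(∅ : Set ℕ)}) := by
  rw [Set.image_singleton]; exact isClosed_singleton

theorem cl_fin (P : Set ℕ → Prop) (m : ℕ) : IsClosed (chi '' {A | P (A ∩ {k | k ≤ m})}) := by
  have hc : Continuous (fun f : ℕ → Bool => fun i : Fin (m+1) => f i) :=
    continuous_pi fun i => continuous_apply _
  have := (isClosed_discrete {g : Fin (m+1) → Bool |
    P {k | ∃ h : k < m + 1, g ⟨k, h⟩ = true}}).preimage hc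
  convert this using 1
  rw [chi_image]
  ext f
  simp only [Set.mem_setOf_eq, Set.mem_preimage]
  have e : {n | f n = true} ∩ {k | k ≤ m} = {k | ∃ _ : k < m + 1, f k = true} := by
    ext k; simp [Nat.lt_succ_iff, and_comm]
  rw [e]

theorem cl_approx {C : Set (Set ℕ)} (hC : IsClosed (chi '' C)) (A : Set ℕ)
    (h : ∀ᶠ k in atTop, A ∩ {j | j ≤ k} ∈ C) : A ∈ C := by
  have ht : Tendsto (fun k => chi (A ∩ {j | j ≤ k})) atTop (𝓝 (chi A)) := by
    rw [tendsto_pi_nhds]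
    intro n
    apply tendsto_const_nhds.congr'
    filter_upwards [eventually_ge_atTop n] with k hk
    rw [Bool.eq_iff_iff, chi_apply, chi_apply]
    simp [hk]
  have := hC.mem_of_tendsto ht (h.mono fun k hk => ⟨_, hk, rfl⟩)
  obtain ⟨B, hB, e⟩ := this
  rwa [← chi_inj e]

theorem phi_mono {φ : Set ℕ → ℝ≥0∞} (h : IsLSCSM φ) {A B : Set ℕ} (hAB : A ⊆ B) : φ A ≤ φ B := by
  have := (h.2.1 A B).1
  rwa [Set.union_eq_right.2 hAB] at this

theorem phi_le_iff {φ : Set ℕ → ℝ≥0∞} (h : IsLSCSM φ) (A : Set ℕ) (c : ℝ≥0∞) :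
    φ A ≤ c ↔ ∀ m, φ (A ∩ {k | k ≤ m}) ≤ c :=
  ⟨fun hA m => (phi_mono h Set.inter_subset_left).trans hA,
   fun hm => le_of_tendsto' (h.2.2 A) hm⟩

theorem cl_iInter {ι : Type*} [Nonempty ι] {C : ι → Set (Set ℕ)}
    (h : ∀ i, IsClosed (chi '' C i)) : IsClosed (chi '' (⋂ i, C i)) := by
  have : chi '' (⋂ i, C i) = ⋂ i, chi '' C i := by
    simp only [chi_image]
    ext f
    simp
  rw [this]
  exact isClosed_iInter h

theorem iii_to_i (I : Set (Set ℕ)) (φ : Set ℕ → ℝ≥0∞) (h : IsLSCSM φ) (hI : I = FinPhi φ) :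
    IsFsigma (chi '' I) := by
  refine ⟨fun n => chi '' {A | φ A ≤ n}, fun n => ?_, ?_⟩
  · have : {A | φ A ≤ n} = ⋂ m, {A : Set ℕ | φ (A ∩ {k | k ≤ m}) ≤ n} := by
      ext A
      simp only [Set.mem_setOf_eq, Set.mem_iInter]
      exact phi_le_iff h A n
    show IsClosed (chi '' {A | φ A ≤ n})
    rw [this]
    exact cl_iInter fun m => cl_fin (fun B => φ B ≤ n) m
  · rw [← Set.image_iUnion]
    congr 1
    ext A
    simp only [hI, FinPhi, Set.mem_setOf_eq, Set.mem_iUnion]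
    constructor
    · intro hA
      obtain ⟨n, hn⟩ := ENNReal.exists_nat_gt hA.ne
      exact ⟨n, hn.le⟩
    · rintro ⟨n, hn⟩
      exact hn.trans_lt (ENNReal.natCast_lt_top n)

/-- finite unions of members of `K` -/
def nUnion (K : Set (Set ℕ)) : ℕ → Set (Set ℕ)
  | 0 => {∅}
  | n + 1 => Set.image2 (· ∪ ·) K (nUnion K n)

theorem ii_to_i (I K : Set (Set ℕ)) (hK : Hereditary K) (hc : IsClosed (chi '' K))
    (h : ∀ B : Set ℕ, B ∈ I ↔ ∃ S : Finset (Set ℕ), ↑S ⊆ K ∧ B ⊆ ⋃₀ ↑S) :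
    IsFsigma (chi '' I) := by
  classical
  refine ⟨fun n => chi '' nUnion K n, fun n => ?_, ?_⟩
  · induction n with
    | zero => exact cl_empty
    | succ n ih => exact cl_union hc ih
  · rw [← Set.image_iUnion]
    congr 1
    ext B
    rw [h, Set.mem_iUnion]
    constructor
    · rintro ⟨S, hS, hB⟩
      induction S using Finset.induction_on generalizing B with
      | empty =>
        refine ⟨0, ?_⟩
        simpa [nUnion, Set.subset_empty_iff] using hB
      | insert A S hA ih =>
        rw [Finset.coe_insert, Set.insert_subset_iff] at hS
        obtain ⟨n, hn⟩ := ih (B \ A) hS.2 (by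
          rw [Finset.coe_insert, Set.sUnion_insert] at hB
          exact Set.diff_subset_iff.2 hB)
        exact ⟨n + 1, B ∩ A, hK A hS.1 _ Set.inter_subset_right, B \ A, hn,
          Set.inter_union_diff B A⟩
    · rintro ⟨n, hn⟩
      induction n generalizing B with
      | zero =>
        refine ⟨∅, by simp, ?_⟩
        have : B = ∅ := hn
        simp [this]
      | succ n ih =>
        obtain ⟨A, hA, D, hD, rfl⟩ := hn
        obtain ⟨S, hS, hB⟩ := ih D hD
        refine ⟨insert A S, ?_, ?_⟩
        · rw [Finset.coe_insert, Set.insert_subset_iff]; exact ⟨hA, hS⟩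
        · rw [Finset.coe_insert, Set.sUnion_insert]
          exact Set.union_subset_union_right _ hB

theorem iii_to_ii (I : Set (Set ℕ)) (hI : IsIdeal I) (hfin : ContainsFin I)
    (φ : Set ℕ → ℝ≥0∞) (h : IsLSCSM φ) (hφ : I = FinPhi φ) :
    ∃ K : Set (Set ℕ), Hereditary K ∧ IsClosed (chi '' K) ∧
        ∀ B : Set ℕ, B ∈ I ↔ ∃ S : Finset (Set ℕ), ↑S ⊆ K ∧ B ⊆ ⋃₀ ↑S := by
  classical
  obtain ⟨h0, -, hU, hD⟩ := hI
  set K : Set (Set ℕ) := {A | ∀ m ∈ A, φ (A \ {k | k ≤ m}) ≤ m} with hKdef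
  have hKI : ∀ A ∈ K, A ∈ I := by
    intro A hA
    rcases A.eq_empty_or_nonempty with rfl | ⟨m, hm⟩
    · exact h0
    · have h1 : A \ {k | k ≤ m} ∈ I := by
        rw [hφ]; exact (hA m hm).trans_lt (ENNReal.natCast_lt_top m)
      have h2 : A ∩ {k | k ≤ m} ∈ I := hfin _ ((Set.finite_le_nat m).subset Set.inter_subset_right)
      rw [← Set.inter_union_diff A {k | k ≤ m}]
      exact hU _ _ h2 h1
  refine ⟨K, ?_, ?_, fun B => ⟨fun hB => ?_, ?_⟩⟩
  · intro A hA B hBA m hm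
    exact (phi_mono h (Set.diff_subset_diff_left hBA)).trans (hA m (hBA hm))
  · have : K = ⋂ p : ℕ × ℕ, {A : Set ℕ | (fun B => p.1 ∈ B →
        φ ((B \ {k | k ≤ p.1}) ∩ {k | k ≤ p.2}) ≤ p.1) (A ∩ {k | k ≤ p.1 + p.2})} := by
      ext A
      simp only [hKdef, Set.mem_setOf_eq, Set.mem_iInter, Prod.forall]
      have e : ∀ m n, ((A ∩ {k | k ≤ m + n}) \ {k | k ≤ m}) ∩ {k | k ≤ n}
          = (A \ {k | k ≤ m}) ∩ {k | k ≤ n} := by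
        intro m n; ext k
        simp only [Set.mem_inter_iff, Set.mem_diff, Set.mem_setOf_eq]
        constructor
        · rintro ⟨⟨⟨a, b⟩, c⟩, d⟩; exact ⟨⟨a, c⟩, d⟩
        · rintro ⟨⟨a, c⟩, d⟩; exact ⟨⟨⟨a, by omega⟩, c⟩, d⟩
      constructor
      · intro hA m n hm
        rw [e]
        exact (phi_le_iff h _ _).1 (hA m hm.1) n
      · intro hA m hm
        rw [phi_le_iff h]
        intro n
        rw [← e]
        exact hA m n ⟨hm, by simp⟩
    rw [this]
    exact cl_iInter fun p => cl_fin (fun B => p.1 ∈ B →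
        φ ((B \ {k | k ≤ p.1}) ∩ {k | k ≤ p.2}) ≤ p.1) _
  · have hlt : φ B < ⊤ := by rw [hφ] at hB; exact hB
    obtain ⟨n, hn⟩ := ENNReal.exists_nat_gt hlt.ne
    refine ⟨insert (B \ {k | k < n}) ((Finset.range n).image fun i => ({i} : Set ℕ)), ?_, ?_⟩
    · rw [Finset.coe_insert, Set.insert_subset_iff]
      constructor
      · intro m hm
        have hnm : n ≤ m := not_lt.1 hm.2
        refine (phi_mono h (Set.diff_subset.trans Set.diff_subset)).trans (hn.le.trans ?_)
        exact_mod_cast hnm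
      · intro A hA
        obtain ⟨i, -, rfl⟩ := Finset.mem_image.1 (Finset.mem_coe.1 hA)
        intro m hm
        have : m = i := hm
        subst this
        have : ({m} : Set ℕ) \ {k | k ≤ m} = ∅ := by ext k; simp; omega
        rw [this, h.1]; exact bot_le
    · intro k hk
      by_cases hkn : k < n
      · refine ⟨{k}, ?_, rfl⟩
        simp only [Finset.coe_insert, Finset.coe_image, Set.mem_insert_iff]
        exact Or.inr ⟨k, by simpa using hkn, rfl⟩
      · exact ⟨B \ {k | k < n}, by simp, hk, hkn⟩
  · rintro ⟨S, hS, hB⟩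
    refine hD _ _ hB ?_
    clear hB
    induction S using Finset.induction_on with
    | empty => simpa using h0
    | insert A S hA ih =>
      rw [Finset.coe_insert, Set.insert_subset_iff] at hS
      rw [Finset.coe_insert, Set.sUnion_insert]
      exact hU _ _ (hKI A hS.1) (ih hS.2)

/-- the increasing sequence of closed hereditary families -/
def Cseq (D : ℕ → Set (Set ℕ)) : ℕ → Set (Set ℕ)
  | 0 => {∅}
  | n + 1 => Set.image2 (· ∪ ·) (Set.image2 (· ∪ ·) (Cseq D n) (Cseq D n)) (D n)

theorem hered_union {C D : Set (Set ℕ)} (hC : Hereditary C) (hD : Hereditary D) :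
    Hereditary (Set.image2 (· ∪ ·) C D) := by
  rintro _ ⟨A, hA, B, hB, rfl⟩ E hE
  refine ⟨E ∩ A, hC A hA _ Set.inter_subset_right, E ∩ B, hD B hB _ Set.inter_subset_right, ?_⟩
  have hE' : E ⊆ A ∪ B := hE
  show E ∩ A ∪ E ∩ B = E
  rw [← Set.inter_union_distrib_left, Set.inter_eq_left.2 hE']

theorem i_to_iii (I : Set (Set ℕ)) (hI : IsIdeal I) (h : IsFsigma (chi '' I)) :
    ∃ φ : Set ℕ → ℝ≥0∞, IsLSCSM φ ∧ I = FinPhi φ := by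
  classical
  obtain ⟨h0, -, hU, hDn⟩ := hI
  obtain ⟨F, hF, hFI⟩ := h
  set D : ℕ → Set (Set ℕ) := fun n => {B | ∃ A ∈ {A | chi A ∈ F n}, B ⊆ A} ∪ {∅} with hDdef
  have hFmem : ∀ A, A ∈ I ↔ ∃ n, chi A ∈ F n := by
    intro A
    rw [← chi_inj.mem_set_image (s := I), hFI, Set.mem_iUnion]
  have hDcl : ∀ n, IsClosed (chi '' D n) := by
    intro n
    rw [hDdef]; simp only; rw [Set.image_union]
    refine (cl_down ?_).union cl_empty
    rw [chi_image]
    simpa [chi_set] using hF n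
  have hDher : ∀ n, Hereditary (D n) := by
    rintro n A (⟨E, hE, hAE⟩ | rfl) B hB
    · exact Or.inl ⟨E, hE, hB.trans hAE⟩
    · exact Or.inr (Set.subset_empty_iff.1 hB)
  have hDe : ∀ n, ∅ ∈ D n := fun n => Or.inr rfl
  have hDI : ∀ n, ∀ A ∈ D n, A ∈ I := by
    rintro n A (⟨E, hE, hAE⟩ | rfl)
    · exact hDn _ _ hAE ((hFmem E).2 ⟨n, hE⟩)
    · exact h0
  set C := Cseq D with hCdef
  have hCcl : ∀ n, IsClosed (chi '' C n) := by
    intro n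
    induction n with
    | zero => exact cl_empty
    | succ n ih => exact cl_union (cl_union ih ih) (hDcl n)
  have hCher : ∀ n, Hereditary (C n) := by
    intro n
    induction n with
    | zero =>
      intro A hA B hB
      have hA' : A = ∅ := hA
      subst hA'
      exact Set.subset_empty_iff.1 hB
    | succ n ih => exact hered_union (hered_union ih ih) (hDher n)
  have hCe : ∀ n, ∅ ∈ C n := by
    intro n
    induction n with
    | zero => rfl
    | succ n ih => exact ⟨∅, ⟨∅, ih, ∅, ih, by simp⟩, ∅, hDe n, by simp⟩
  have hCU : ∀ n A B, A ∈ C n → B ∈ C n → A ∪ B ∈ C (n + 1) := fun n A B hA hB =>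
    ⟨A ∪ B, ⟨A, hA, B, hB, rfl⟩, ∅, hDe n, by simp⟩
  have hCmono : Monotone C := monotone_nat_of_le_succ fun n A hA => by
    simpa using hCU n A ∅ hA (hCe n)
  have hCD : ∀ n A, A ∈ D n → A ∈ C (n + 1) := fun n A hA =>
    ⟨∅, ⟨∅, hCe n, ∅, hCe n, by simp⟩, A, hA, by simp⟩
  have hCI : ∀ n, ∀ A ∈ C n, A ∈ I := by
    intro n
    induction n with
    | zero =>
      intro A hA
      have hA' : A = ∅ := hA
      subst hA'; exact h0
    | succ n ih =>
      rintro _ ⟨_, ⟨A, hA, B, hB, rfl⟩, E, hE, rfl⟩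
      exact hU _ _ (hU _ _ (ih A hA) (ih B hB)) (hDI n E hE)
  -- the submeasure
  set φ : Set ℕ → ℝ≥0∞ := fun A => ⨅ n : {n // A ∈ C n}, ((n : ℕ) : ℝ≥0∞) with hφ
  have hle : ∀ A n, A ∈ C n → φ A ≤ n := fun A n hA => iInf_le_of_le ⟨n, hA⟩ le_rfl
  have hlt : ∀ A (c : ℝ≥0∞), φ A < c → ∃ n : ℕ, A ∈ C n ∧ (n : ℝ≥0∞) < c := by
    intro A c hc
    obtain ⟨⟨n, hn⟩, hnc⟩ := iInf_lt_iff.1 hc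
    exact ⟨n, hn, hnc⟩
  have hatt : ∀ A, φ A < ⊤ → ∃ n : ℕ, A ∈ C n ∧ φ A = n := by
    intro A hA
    obtain ⟨n, hn, -⟩ := hlt A ⊤ hA
    have hex : ∃ n, A ∈ C n := ⟨n, hn⟩
    refine ⟨Nat.find hex, Nat.find_spec hex, le_antisymm (hle _ _ (Nat.find_spec hex)) ?_⟩
    refine le_iInf fun p => ?_
    exact_mod_cast Nat.find_min' hex p.2
  have hmono : ∀ A B, A ⊆ B → φ A ≤ φ B := by
    intro A B hAB
    exact le_iInf fun p => hle _ _ (hCher _ B p.2 A hAB)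
  have hsub : ∀ A B, φ (A ∪ B) ≤ φ A + φ B := by
    intro A B
    by_cases hA : φ A < ⊤
    swap
    · rw [not_lt_top_iff.1 hA, top_add]; exact le_top
    by_cases hB : φ B < ⊤
    swap
    · rw [not_lt_top_iff.1 hB, add_top]; exact le_top
    obtain ⟨n, hn, en⟩ := hatt A hA
    obtain ⟨m, hm, em⟩ := hatt B hB
    rcases Nat.eq_zero_or_pos n with rfl | hn0
    · have : A = ∅ := hn
      subst this
      rw [Set.empty_union]; exact le_add_self
    rcases Nat.eq_zero_or_pos m with rfl | hm0
    · have : B = ∅ := hm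
      subst this
      rw [Set.union_empty]; exact le_self_add
    rw [en, em, ← Nat.cast_add]
    apply hle
    exact hCmono (by omega) (hCU (max n m) A B (hCmono (le_max_left _ _) hn)
      (hCmono (le_max_right _ _) hm))
  refine ⟨φ, ⟨?_, fun A B => ⟨hmono _ _ Set.subset_union_left, hsub A B⟩, fun A => ?_⟩, ?_⟩
  · simpa using hle ∅ 0 (hCe 0)
  · have hm : Monotone (fun n => φ (A ∩ {k | k ≤ n})) := fun a b hab =>
      hmono _ _ (Set.inter_subset_inter_right _ fun k (hk : k ≤ a) => hk.trans hab)
    have ht := tendsto_atTop_iSup hm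
    suffices e : (⨆ n, φ (A ∩ {k | k ≤ n})) = φ A by rwa [e] at ht
    apply le_antisymm (iSup_le fun n => hmono _ _ Set.inter_subset_left)
    by_contra hcon
    rw [not_le] at hcon
    -- each approximation has a level bounded by the sup; take a natural bound
    have hs : (⨆ n, φ (A ∩ {k | k ≤ n})) < ⊤ := hcon.trans_le le_top
    obtain ⟨N, hN⟩ := ENNReal.exists_nat_gt hs.ne
    have hex : ∃ N : ℕ, (⨆ n, φ (A ∩ {k | k ≤ n})) ≤ N := ⟨N, hN.le⟩
    have hfs := Nat.find_spec hex
    have hAC : ∀ M : ℕ, (⨆ n, φ (A ∩ {k | k ≤ n})) ≤ M → φ A ≤ M := by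
      intro M hM
      apply hle
      refine cl_approx (hCcl M) A (Eventually.of_forall fun k => ?_)
      have h1 : φ (A ∩ {j | j ≤ k}) ≤ M := (le_iSup (fun n => φ (A ∩ {k | k ≤ n})) k).trans hM
      obtain ⟨n, hn, en⟩ := hatt _ (h1.trans_lt (ENNReal.natCast_lt_top M))
      rw [en] at h1
      exact hCmono (by exact_mod_cast h1) hn
    -- the values are naturals, so the sup is attained
    have hnat : ∃ M : ℕ, (⨆ n, φ (A ∩ {k | k ≤ n})) = M := by
      by_cases hz : Nat.find hex = 0
      · refine ⟨0, le_antisymm ?_ (by simp)⟩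
        rwa [hz] at hfs
      · obtain ⟨L, hL⟩ := Nat.exists_eq_succ_of_ne_zero hz
        have hnot := Nat.find_min hex (m := L) (by omega)
        rw [not_le, lt_iSup_iff] at hnot
        obtain ⟨k, hk⟩ := hnot
        refine ⟨L + 1, le_antisymm (by rw [hL] at hfs; exact hfs) ?_⟩
        have h1 : φ (A ∩ {j | j ≤ k}) ≤ ⨆ n, φ (A ∩ {k | k ≤ n}) :=
          le_iSup (fun n => φ (A ∩ {k | k ≤ n})) k
        refine le_trans ?_ h1
        obtain ⟨n, hn, en⟩ := hatt _ (h1.trans_lt hs)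
        rw [en] at hk ⊢
        have : L < n := by exact_mod_cast hk
        exact_mod_cast this
    obtain ⟨M, hM⟩ := hnat
    have := hAC M hM.le
    rw [hM] at hcon
    exact absurd hcon (not_lt.2 this)
  · ext A
    constructor
    · intro hA
      obtain ⟨n, hn⟩ := (hFmem A).1 hA
      exact (hle A (n+1) (hCD n A (Or.inl ⟨A, hn, subset_rfl⟩))).trans_lt
        (ENNReal.natCast_lt_top _)
    · intro hA
      obtain ⟨n, hn, -⟩ := hatt A hA
      exact hCI n A hn

theorem mazur (I : Set (Set ℕ)) (hI : IsIdeal I) (hfin : ContainsFin I) :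
    (IsFsigma (chi '' I) ↔
      ∃ K : Set (Set ℕ), Hereditary K ∧ IsClosed (chi '' K) ∧
        ∀ B : Set ℕ, B ∈ I ↔ ∃ S : Finset (Set ℕ), ↑S ⊆ K ∧ B ⊆ ⋃₀ ↑S) ∧
    (IsFsigma (chi '' I) ↔ ∃ φ : Set ℕ → ℝ≥0∞, IsLSCSM φ ∧ I = FinPhi φ) := by
  refine ⟨⟨fun h => ?_, ?_⟩, ⟨i_to_iii I hI, ?_⟩⟩
  · obtain ⟨φ, h1, h2⟩ := i_to_iii I hI h
    exact iii_to_ii I hI hfin φ h1 h2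
  · rintro ⟨K, h1, h2, h3⟩
    exact ii_to_i I K h1 h2 h3
  · rintro ⟨φ, h1, h2⟩
    exact iii_to_i I φ h1 h2
end

section
/- (Solecki) Let I be an analytic ideal on ℕ containing all finite sets. Then I is a P-ideal if and only if there is a lower semicontinuous submeasure φ such that I = Exh(φ) = {A ⊆ ℕ : lim_{n→∞} φ(A \ {0,1,…,n}) = 0}. In particular, every analytic P-ideal on ℕ is an Fσδ subset of 2^ℕ. -/
open Set Filter Topology ENNReal

/-- `Fσδ`: countable intersection of `Fσ` sets. -/
def IsFsigmadelta {Y : Type*} [TopologicalSpace Y] (S : Set Y) : Prop :=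
  ∃ F : ℕ → Set Y, (∀ n, IsFsigma (F n)) ∧ S = ⋂ n, F n

/-- `Exh(φ) = {A : φ(A \ {0,…,n}) → 0}`. -/
def ExhPhi (φ : Set ℕ → ℝ≥0∞) : Set (Set ℕ) :=
  {A | Tendsto (fun n => φ (A \ {k | k ≤ n})) atTop (nhds 0)}

/-- `I` is a P-ideal: every countable family in `I` has a pseudo-union in `I`. -/
def IsPIdeal (I : Set (Set ℕ)) : Prop :=
  ∀ E : ℕ → Set ℕ, (∀ n, E n ∈ I) → ∃ F ∈ I, ∀ n, (E n \ F).Finite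

open PiNat

namespace SoleckiProof

/-- hereditary and closed families of sets -/
def Good (F : Set (Set ℕ)) : Prop :=
  (∀ a b : Set ℕ, a ⊆ b → b ∈ F → a ∈ F) ∧ ∀ x : Set ℕ, (∀ N, x ∩ Iio N ∈ F) → x ∈ F

def Large (I F : Set (Set ℕ)) : Prop := ∀ x ∈ I, ∃ m, x \ Iio m ∈ F

def Cl (A : Set (Set ℕ)) : Set (Set ℕ) := {x | ∀ N, ∃ y ∈ A, x ∩ Iio N ⊆ y}

def Cof (f : (ℕ → ℕ) → Set ℕ) (A : Set (ℕ → ℕ)) : Prop :=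
  ∀ x ∈ range f, ∃ z ∈ A, ∃ m, x \ Iio m ⊆ f z

def ZZ (f : (ℕ → ℕ) → Set ℕ) : Set (ℕ → ℕ) := {z | ∀ k, Cof f (cylinder z k)}

def Cont (f : (ℕ → ℕ) → Set ℕ) : Prop :=
  ∀ z N, ∃ k, ∀ w ∈ cylinder z k, f w ∩ Iio N = f z ∩ Iio N

lemma good_cl (A : Set (Set ℕ)) : Good (Cl A) := by
  constructor
  · intro a b hab hb N
    obtain ⟨y, hy, h⟩ := hb N
    exact ⟨y, hy, fun t ht => h ⟨hab ht.1, ht.2⟩⟩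
  · intro x hx N
    obtain ⟨y, hy, h⟩ := hx N N
    exact ⟨y, hy, fun t ht => h ⟨ht, ht.2⟩⟩

lemma good_inter {F G : Set (Set ℕ)} (hF : Good F) (hG : Good G) : Good (F ∩ G) :=
  ⟨fun a b hab hb => ⟨hF.1 a b hab hb.1, hG.1 a b hab hb.2⟩,
    fun x hx => ⟨hF.2 x fun N => (hx N).1, hG.2 x fun N => (hx N).2⟩⟩

lemma large_inter {I F G : Set (Set ℕ)} (hF : Good F) (hG : Good G) (h1 : Large I F)
    (h2 : Large I G) : Large I (F ∩ G) := by
  intro x hx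
  obtain ⟨m, hm⟩ := h1 x hx
  obtain ⟨n, hn⟩ := h2 x hx
  refine ⟨max m n, hF.1 _ _ ?_ hm, hG.1 _ _ ?_ hn⟩
  · rintro t ⟨ht, h⟩
    refine ⟨ht, ?_⟩
    simp at h ⊢
    omega
  · rintro t ⟨ht, h⟩
    refine ⟨ht, ?_⟩
    simp at h ⊢
    omega

lemma cof_iUnion {f : (ℕ → ℕ) → Set ℕ} (hP : IsPIdeal (range f)) {ι : Type} [Countable ι]
    [Nonempty ι] (A : ι → Set (ℕ → ℕ)) (h : Cof f (⋃ i, A i)) : ∃ i, Cof f (A i) := by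
  by_contra! hc
  obtain ⟨e, he⟩ := exists_surjective_nat ι
  simp only [Cof] at hc
  push Not at hc
  choose x hx hx' using hc
  obtain ⟨F, hF, hF'⟩ := hP (fun n => x (e n)) (fun n => hx _)
  obtain ⟨z, hz, m, hm⟩ := h F hF
  obtain ⟨i, hi⟩ := mem_iUnion.1 hz
  obtain ⟨n, rfl⟩ := he i
  obtain ⟨b, hb⟩ := (hF' n).bddAbove
  apply hx' (e n) z hi (max m (b + 1))
  rintro t ⟨ht, h⟩
  simp at h
  apply hm
  refine ⟨?_, by simp; omega⟩
  by_contra hh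
  have := hb ⟨ht, hh⟩
  omega

lemma cof_inter {f : (ℕ → ℕ) → Set ℕ} (hP : IsPIdeal (range f)) (A : Set (ℕ → ℕ))
    (h : Cof f A) : Cof f (A ∩ ZZ f) := by
  classical
  let B : Option (List ℕ) → Set (ℕ → ℕ) := fun o => match o with
    | none => A ∩ ZZ f
    | some s => {z | res z s.length = s ∧ ¬ Cof f (cylinder z s.length)}
  have hB : Cof f (⋃ i, B i) := by
    intro x hx
    obtain ⟨z, hz, hm⟩ := h x hx
    refine ⟨z, ?_, hm⟩
    by_cases hzz : z ∈ ZZ f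
    · exact mem_iUnion.2 ⟨none, hz, hzz⟩
    · simp only [ZZ, mem_ofPred_eq, not_forall] at hzz
      obtain ⟨k, hk⟩ := hzz
      refine mem_iUnion.2 ⟨some (res z k), ?_⟩
      simp only [B, mem_ofPred_eq, res_length]
      exact ⟨trivial, hk⟩
  obtain ⟨i, hi⟩ := cof_iUnion hP B hB
  cases i with
  | none => exact hi
  | some s =>
    exfalso
    obtain ⟨z, hz, _⟩ := hi (f 0) ⟨0, rfl⟩
    apply hz.2
    intro x hx
    obtain ⟨w, hw, hm⟩ := hi x hx
    refine ⟨w, ?_, hm⟩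
    rw [cylinder_eq_res]
    exact hw.1.trans hz.1.symm

lemma large_cl {f : (ℕ → ℕ) → Set ℕ} {A : Set (ℕ → ℕ)} (h : Cof f A) :
    Large (range f) (Cl (f '' A)) := by
  intro x hx
  obtain ⟨z, hz, m, hm⟩ := h x hx
  exact ⟨m, fun N => ⟨f z, ⟨z, hz, rfl⟩, inter_subset_left.trans hm⟩⟩

lemma limit_exists (z : ℕ → ℕ → ℕ) (k : ℕ → ℕ) (hz : ∀ j, z (j + 1) ∈ cylinder (z j) (k j))
    (hk : ∀ j, k j < k (j + 1)) : ∃ w, ∀ j, w ∈ cylinder (z j) (k j) := by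
  have hmono : StrictMono k := strictMono_nat_of_lt_succ hk
  have key : ∀ j l, j ≤ l → ∀ i < k j, z l i = z j i := by
    intro j l hjl
    induction l, hjl using Nat.le_induction with
    | base => intros; rfl
    | succ l hl ih =>
      intro i hi
      rw [hz l i (hi.trans_le (hmono.monotone hl)), ih i hi]
  refine ⟨fun i => z (i + 1) i, fun j i hi => ?_⟩
  have : i < k (i + 1) := hmono.id_le (i + 1)
  rcases le_total j (i + 1) with h | h
  · exact key _ _ h i hi
  · exact (key _ _ h i this).symm

lemma cyl_mono {z : ℕ → ℕ} {k l : ℕ} (h : k ≤ l) : cylinder z l ⊆ cylinder z k :=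
  fun _ hw i hi => hw i (hi.trans_le h)

/-- Step A -/
lemma stepA {I : Set (Set ℕ)} (hI : IsIdeal I) (hfin : ContainsFin I)
    {f : (ℕ → ℕ) → Set ℕ} (hr : range f = I) (hc : Cont f) (hne : (ZZ f).Nonempty) (x : Set ℕ)
    (hx : ∀ z ∈ ZZ f, ∀ k, ∃ m, x \ Iio m ∈ Cl (f '' (cylinder z k ∩ ZZ f))) : x ∈ I := by
  have hx' : ∀ s : ZZ f × ℕ, ∃ m, x \ Iio m ∈ Cl (f '' (cylinder s.1.1 s.2 ∩ ZZ f)) :=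
    fun s => hx _ s.1.2 _
  choose g hg using hx'
  have hstep : ∀ (s : ZZ f × ℕ) (n : ℕ), ∃ t : ZZ f × ℕ, t.1.1 ∈ cylinder s.1.1 s.2 ∧
      s.2 < t.2 ∧ (∀ p ∈ x, g s ≤ p → p < n → p ∈ f t.1.1) ∧
      ∀ w ∈ cylinder t.1.1 t.2, f w ∩ Iio n = f t.1.1 ∩ Iio n := by
    intro s n
    obtain ⟨_, ⟨z, hz, rfl⟩, h⟩ := hg s n
    obtain ⟨k, hk⟩ := hc z n
    refine ⟨(⟨z, hz.2⟩, max k (s.2 + 1)), hz.1, by simp, ?_, ?_⟩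
    · intro p hp h1 h2
      exact h ⟨⟨hp, by simpa using h1⟩, h2⟩
    · intro w hw
      exact hk w (cyl_mono (le_max_left _ _) hw)
  choose step h1 h2 h3 h4 using hstep
  obtain ⟨z0, hz0⟩ := hne
  let q : ℕ → (ZZ f × ℕ) × (ZZ f × ℕ) := fun i => Nat.rec ((⟨z0, hz0⟩, 0), (⟨z0, hz0⟩, 0))
    (fun i p => (p.2, step p.1 (max (g p.2) i))) i
  let T : ℕ → ZZ f × ℕ := fun i => (q i).1
  let n : ℕ → ℕ := fun i => max (g (T (i + 1))) i
  have hT : ∀ i, T (i + 2) = step (T i) (n i) := fun i => rfl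
  have lim : ∀ r, ∃ w, ∀ j, w ∈ cylinder (T (2 * j + r)).1.1 (T (2 * j + r)).2 := by
    intro r
    refine limit_exists (fun j => (T (2 * j + r)).1.1) (fun j => (T (2 * j + r)).2) ?_ ?_
    · intro j
      have : 2 * (j + 1) + r = 2 * j + r + 2 := by ring
      simp only [this, hT]
      exact h1 _ _
    · intro j
      have : 2 * (j + 1) + r = 2 * j + r + 2 := by ring
      simp only [this, hT]
      exact h2 _ _
  have cov : ∀ r w, (∀ j, w ∈ cylinder (T (2 * j + r)).1.1 (T (2 * j + r)).2) →
      ∀ j, ∀ p ∈ x, g (T (2 * j + r)) ≤ p → p < n (2 * j + r) → p ∈ f w := by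
    intro r w hw j p hp ha hb
    have e : 2 * (j + 1) + r = 2 * j + r + 2 := by ring
    have hw' := hw (j + 1)
    rw [e, hT] at hw'
    have := h4 _ _ w hw'
    have hm : p ∈ f w ∩ Iio (n (2 * j + r)) := by
      rw [this]; exact ⟨h3 _ _ p hp ha hb, hb⟩
    exact hm.1
  obtain ⟨w, hw⟩ := lim 0
  obtain ⟨w', hw'⟩ := lim 1
  refine hI.2.2.2 x (Iio (g (T 0)) ∪ (f w ∪ f w')) ?_ (hI.2.2.1 _ _ (hfin _ (finite_Iio _))
    (hI.2.2.1 _ _ (hr ▸ mem_range_self _) (hr ▸ mem_range_self _)))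
  intro p hp
  by_cases hp0 : p < g (T 0)
  · exact Or.inl hp0
  right
  have : ∃ i, g (T i) ≤ p ∧ p < n i := by
    by_contra! hcon
    have : ∀ i, g (T i) ≤ p := by
      intro i
      induction i with
      | zero => omega
      | succ i ih =>
        exact (le_max_left _ _).trans (hcon i ih)
    have h5 := hcon (p + 1) (this (p + 1))
    have : p + 1 ≤ n (p + 1) := le_max_right _ _
    omega
  obtain ⟨i, ha, hb⟩ := this
  rcases Nat.even_or_odd' i with ⟨j, rfl | rfl⟩
  · exact Or.inl (cov 0 w hw j p hp ha hb)
  · exact Or.inr (cov 1 w' hw' j p hp ha hb)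

/-- Step B -/
lemma stepB {I : Set (Set ℕ)} (hI : IsIdeal I)
    {f : (ℕ → ℕ) → Set ℕ} (hr : range f = I) (hc : Cont f) (hne : (ZZ f).Nonempty)
    (hZ : ∀ z ∈ ZZ f, ∀ k, Cof f (cylinder z k ∩ ZZ f))
    (F : Set (Set ℕ)) (hF : Good F) (hL : Large I F) :
    ∃ F', Good F' ∧ Large I F' ∧ ∀ a ∈ F', ∀ b ∈ F', a ∪ b ∈ F := by
  have main : ∃ (s : ZZ f × ZZ f × ℕ) (m : ℕ), ∀ z ∈ cylinder s.1.1 s.2.2 ∩ ZZ f,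
      ∀ w ∈ cylinder s.2.1.1 s.2.2 ∩ ZZ f, (f z ∪ f w) \ Iio m ∈ F := by
    by_contra! hcon
    have hstep : ∀ (s : ZZ f × ZZ f × ℕ) (m : ℕ), ∃ t : ZZ f × ZZ f × ℕ,
        t.1.1 ∈ cylinder s.1.1 s.2.2 ∧ t.2.1.1 ∈ cylinder s.2.1.1 s.2.2 ∧ s.2.2 < t.2.2 ∧
        ∀ z ∈ cylinder t.1.1 t.2.2, ∀ w ∈ cylinder t.2.1.1 t.2.2, (f z ∪ f w) \ Iio m ∉ F := by
      intro s m
      obtain ⟨z, hz, w, hw, h⟩ := hcon s m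
      have : ∃ N, ((f z ∪ f w) \ Iio m) ∩ Iio N ∉ F := by
        by_contra! h'
        exact h (hF.2 _ h')
      obtain ⟨N, hN⟩ := this
      obtain ⟨k, hk⟩ := hc z N
      obtain ⟨l, hl⟩ := hc w N
      refine ⟨(⟨z, hz.2⟩, ⟨w, hw.2⟩, max (max k l) (s.2.2 + 1)), hz.1, hw.1, by simp, ?_⟩
      intro z' hz' w' hw' hmem
      have ez := hk z' (cyl_mono ((le_max_left _ _).trans (le_max_left _ _)) hz')
      have ew := hl w' (cyl_mono ((le_max_right _ _).trans (le_max_left _ _)) hw')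
      apply hN
      refine hF.1 _ _ ?_ hmem
      rintro t ⟨⟨ht | ht, h1⟩, h2⟩
      · have : t ∈ f z' ∩ Iio N := by rw [ez]; exact ⟨ht, h2⟩
        exact ⟨Or.inl this.1, h1⟩
      · have : t ∈ f w' ∩ Iio N := by rw [ew]; exact ⟨ht, h2⟩
        exact ⟨Or.inr this.1, h1⟩
    choose step h1 h2 h3 h4 using hstep
    obtain ⟨z0, hz0⟩ := hne
    let T : ℕ → ZZ f × ZZ f × ℕ := fun i => Nat.rec (⟨z0, hz0⟩, ⟨z0, hz0⟩, 0)
      (fun i p => step p i) i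
    have hT : ∀ i, T (i + 1) = step (T i) i := fun i => rfl
    obtain ⟨a, ha⟩ := limit_exists (fun j => (T j).1.1) (fun j => (T j).2.2)
      (fun j => by simp only [hT]; exact h1 _ _) (fun j => by simp only [hT]; exact h3 _ _)
    obtain ⟨b, hb⟩ := limit_exists (fun j => (T j).2.1.1) (fun j => (T j).2.2)
      (fun j => by simp only [hT]; exact h2 _ _) (fun j => by simp only [hT]; exact h3 _ _)
    obtain ⟨m, hm⟩ := hL (f a ∪ f b) (hI.2.2.1 _ _ (hr ▸ mem_range_self _) (hr ▸ mem_range_self _))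
    exact h4 (T m) m a (ha (m + 1)) b (hb (m + 1)) hm
  obtain ⟨⟨z, w, k⟩, m, h⟩ := main
  have gM : Good {x : Set ℕ | x ⊆ Ici m} :=
    ⟨fun a b hab hb => hab.trans hb, fun x hx t ht => hx (t + 1) ⟨ht, by simp⟩⟩
  have lM : Large I {x : Set ℕ | x ⊆ Ici m} := by
    intro x _
    exact ⟨m, fun t ht => by simpa using ht.2⟩
  refine ⟨(Cl (f '' (cylinder z.1 k ∩ ZZ f)) ∩ Cl (f '' (cylinder w.1 k ∩ ZZ f))) ∩
    {x : Set ℕ | x ⊆ Ici m}, good_inter (good_inter (good_cl _) (good_cl _)) gM,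
    large_inter (good_inter (good_cl _) (good_cl _)) gM
      (large_inter (good_cl _) (good_cl _) ?_ ?_) lM, ?_⟩
  · exact hr ▸ large_cl (hZ _ z.2 k)
  · exact hr ▸ large_cl (hZ _ w.2 k)
  · rintro a ⟨⟨ha, -⟩, ha'⟩ b ⟨⟨-, hb⟩, hb'⟩
    apply hF.2
    intro N
    obtain ⟨_, ⟨z', hz', rfl⟩, hz⟩ := ha N
    obtain ⟨_, ⟨w', hw', rfl⟩, hw⟩ := hb N
    refine hF.1 _ _ ?_ (h z' hz' w' hw')
    rintro t ⟨ht | ht, h2⟩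
    · exact ⟨Or.inl (hz ⟨ht, h2⟩), by simpa using ha' ht⟩
    · exact ⟨Or.inr (hw ⟨ht, h2⟩), by simpa using hb' ht⟩

lemma exists_G {I : Set (Set ℕ)} (hI : IsIdeal I) (hfin : ContainsFin I) (hP : IsPIdeal I)
    {f : (ℕ → ℕ) → Set ℕ} (hr : range f = I) (hc : Cont f) :
    ∃ G : ℕ → Set (Set ℕ), (∀ n, Good (G n)) ∧ (∀ n, Large I (G n)) ∧
      (∀ n, ∀ a ∈ G (n + 1), ∀ b ∈ G (n + 1), ∀ c ∈ G (n + 1), a ∪ b ∪ c ∈ G n) ∧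
      ∀ x, (∀ n, ∃ m, x \ Iio m ∈ G n) → x ∈ I := by
  classical
  have hP' : IsPIdeal (range f) := hr ▸ hP
  have hu : Cof f univ := by
    rintro x ⟨z, rfl⟩
    exact ⟨z, trivial, 0, sdiff_subset⟩
  have hne : (ZZ f).Nonempty := by
    obtain ⟨z, hz, _⟩ := cof_inter hP' _ hu (f 0) ⟨0, rfl⟩
    exact ⟨z, hz.2⟩
  have hZ : ∀ z ∈ ZZ f, ∀ k, Cof f (cylinder z k ∩ ZZ f) :=
    fun z hz k => cof_inter hP' _ (hz k)
  let K : List ℕ → Set (Set ℕ) := fun s => Cl (f '' ({z | res z s.length = s} ∩ ZZ f))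
  obtain ⟨e, he⟩ := exists_surjective_nat (List ℕ)
  let F : ℕ → Set (Set ℕ) := fun n => if Large I (K (e n)) then K (e n) else univ
  have hFg : ∀ n, Good (F n) := by
    intro n
    simp only [F]
    split_ifs
    · exact good_cl _
    · exact ⟨fun _ _ _ _ => trivial, fun _ _ => trivial⟩
  have hFl : ∀ n, Large I (F n) := by
    intro n
    simp only [F]
    split_ifs with h
    · exact h
    · exact fun _ _ => ⟨0, trivial⟩
  have hB : ∀ H : {H : Set (Set ℕ) // Good H ∧ Large I H},
      ∃ H' : {H : Set (Set ℕ) // Good H ∧ Large I H},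
      ∀ a ∈ H'.1, ∀ b ∈ H'.1, ∀ c ∈ H'.1, a ∪ b ∪ c ∈ H.1 := by
    rintro ⟨H, g, l⟩
    obtain ⟨H1, g1, l1, h1⟩ := stepB hI hr hc hne hZ H g l
    obtain ⟨H2, g2, l2, h2⟩ := stepB hI hr hc hne hZ H1 g1 l1
    refine ⟨⟨H2, g2, l2⟩, fun a ha b hb c hc => h1 _ (h2 a ha b hb) _ ?_⟩
    have := h2 c hc c hc
    rwa [union_self] at this
  choose P hPP using hB
  let G : ℕ → {H : Set (Set ℕ) // Good H ∧ Large I H} := fun n => Nat.rec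
    ⟨F 0, hFg 0, hFl 0⟩ (fun n H => ⟨(P H).1 ∩ F (n + 1), good_inter (P H).2.1 (hFg _),
      large_inter (P H).2.1 (hFg _) (P H).2.2 (hFl _)⟩) n
  have hGF : ∀ n, (G n).1 ⊆ F n := by
    intro n
    cases n with
    | zero => exact subset_rfl
    | succ n => exact inter_subset_right
  refine ⟨fun n => (G n).1, fun n => (G n).2.1, fun n => (G n).2.2, ?_, ?_⟩
  · intro n a ha b hb c hc
    exact hPP (G n) a ha.1 b hb.1 c hc.1
  · intro x hx
    refine stepA hI hfin hr hc hne x fun z hz k => ?_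
    obtain ⟨n, hn⟩ := he (res z k)
    obtain ⟨m, hm⟩ := hx n
    refine ⟨m, ?_⟩
    have eq : K (e n) = Cl (f '' (cylinder z k ∩ ZZ f)) := by
      simp only [K, hn, res_length, cylinder_eq_res]
    have hl : Large I (K (e n)) := by
      rw [eq]; exact hr ▸ large_cl (hZ z hz k)
    have := hGF n hm
    simp only [F, if_pos hl] at this
    rwa [eq] at this

/-- weight of a list of codes -/
noncomputable def wt (l : List (Set ℕ × ℕ)) : ℝ := (l.map fun p => (1 / 2 : ℝ) ^ p.2).sum

def un (l : List (Set ℕ × ℕ)) : Set ℕ := {t | ∃ p ∈ l, t ∈ p.1}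

lemma wt_nonneg (l : List (Set ℕ × ℕ)) : 0 ≤ wt l := by
  apply List.sum_nonneg
  intro r hr
  obtain ⟨p, _, rfl⟩ := List.mem_map.1 hr
  positivity

lemma wt_append (l l' : List (Set ℕ × ℕ)) : wt (l ++ l') = wt l + wt l' := by
  simp [wt]

lemma wt_cons (p : Set ℕ × ℕ) (l : List (Set ℕ × ℕ)) : wt (p :: l) = (1 / 2) ^ p.2 + wt l := by
  simp [wt]

lemma wt_split (l : List (Set ℕ × ℕ)) : ∀ c d : ℝ, 0 < c → 0 < d → wt l < c + d → l ≠ [] →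
    ∃ l1 p l2, l = l1 ++ p :: l2 ∧ wt l1 < c ∧ wt l2 < d := by
  induction l with
  | nil => intro c d _ _ _ h; exact absurd rfl h
  | cons x l ih =>
    intro c d hc hd h _
    by_cases hl : wt l < d
    · exact ⟨[], x, l, rfl, by simpa [wt] using hc, hl⟩
    · push Not at hl
      rw [wt_cons] at h
      have hne : l ≠ [] := by
        rintro rfl
        simp [wt] at hl
        linarith
      obtain ⟨l1, p, l2, e, h1, h2⟩ := ih (c - (1 / 2) ^ x.2) d (by linarith) hd (by linarith) hne
      exact ⟨x :: l1, p, l2, by simp [e], by rw [wt_cons]; linarith, h2⟩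

lemma key {G : ℕ → Set (Set ℕ)} (h0 : ∀ n, ∅ ∈ G n)
    (h3 : ∀ n, ∀ a ∈ G (n + 1), ∀ b ∈ G (n + 1), ∀ c ∈ G (n + 1), a ∪ b ∪ c ∈ G n) :
    ∀ (L : ℕ) (l : List (Set ℕ × ℕ)), l.length ≤ L → (∀ p ∈ l, p.1 ∈ G p.2) →
      ∀ n, wt l < (1 / 2) ^ n → un l ∈ G n := by
  have hmono : Antitone G := by
    apply antitone_nat_of_succ_le
    intro n a ha
    have := h3 n a ha a ha a ha
    simpa using this
  have hnil : un [] = ∅ := by ext; simp [un]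
  intro L
  induction L with
  | zero =>
    intro l hl _ n _
    have : l = [] := List.length_eq_zero_iff.1 (by omega)
    rw [this, hnil]
    exact h0 n
  | succ L ih =>
    intro l hl hG n hn
    by_cases hne : l = []
    · rw [hne, hnil]; exact h0 n
    have hp : (0 : ℝ) < (1 / 2) ^ (n + 1) := by positivity
    obtain ⟨l1, p, l2, e, h1, h2⟩ := wt_split l _ _ hp hp (by rw [pow_succ]; linarith) hne
    subst e
    have hlen : l1.length + l2.length ≤ L := by
      simp at hl; omega
    have a1 := ih l1 (by omega) (fun q hq => hG q (by simp [hq])) (n + 1) h1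
    have a2 := ih l2 (by omega) (fun q hq => hG q (by simp [hq])) (n + 1) h2
    have a3 : p.1 ∈ G (n + 1) := by
      refine hmono ?_ (hG p (by simp))
      rw [wt_append, wt_cons] at hn
      have : (1 / 2 : ℝ) ^ p.2 < (1 / 2) ^ n := by
        linarith [wt_nonneg l1, wt_nonneg l2]
      exact (pow_lt_pow_iff_right_of_lt_one₀ (by norm_num) (by norm_num)).1 this
    have := h3 n _ a1 _ a3 _ a2
    convert this using 1
    ext t
    simp only [un, List.mem_append, List.mem_cons, mem_ofPred_eq, mem_union]
    constructor
    · rintro ⟨q, h | rfl | h, ht⟩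
      · exact Or.inl (Or.inl ⟨q, h, ht⟩)
      · exact Or.inl (Or.inr ht)
      · exact Or.inr ⟨q, h, ht⟩
    · rintro ((⟨q, h, ht⟩ | ht) | ⟨q, h, ht⟩)
      · exact ⟨q, Or.inl h, ht⟩
      · exact ⟨p, Or.inr (Or.inl rfl), ht⟩
      · exact ⟨q, Or.inr (Or.inr h), ht⟩

noncomputable def pre (G : ℕ → Set (Set ℕ)) (x : Set ℕ) : ℝ≥0∞ :=
  ⨅ (l : List (Set ℕ × ℕ)) (_ : (∀ p ∈ l, p.1 ∈ G p.2) ∧ x ⊆ un l), ENNReal.ofReal (wt l)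

noncomputable def phi (G : ℕ → Set (Set ℕ)) (x : Set ℕ) : ℝ≥0∞ := ⨆ n : ℕ, pre G (x ∩ {k | k ≤ n})

lemma pre_mono (G : ℕ → Set (Set ℕ)) : Monotone (pre G) := by
  intro x y hxy
  refine le_iInf₂ fun l hl => ?_
  exact iInf₂_le l ⟨hl.1, hxy.trans hl.2⟩

lemma pre_union (G : ℕ → Set (Set ℕ)) (x y : Set ℕ) : pre G (x ∪ y) ≤ pre G x + pre G y := by
  unfold pre
  simp only [iInf_add, add_iInf]
  refine le_iInf₂ fun l hl => le_iInf₂ fun l' hl' => ?_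
  have hmem : (∀ p ∈ l' ++ l, p.1 ∈ G p.2) ∧ x ∪ y ⊆ un (l' ++ l) := by
    constructor
    · intro p hp
      rcases List.mem_append.1 hp with h | h
      · exact hl'.1 p h
      · exact hl.1 p h
    · rintro t (ht | ht)
      · obtain ⟨p, hp, h⟩ := hl'.2 ht
        exact ⟨p, by simp [hp], h⟩
      · obtain ⟨p, hp, h⟩ := hl.2 ht
        exact ⟨p, by simp [hp], h⟩
  refine (iInf₂_le (l' ++ l) hmem).trans ?_
  rw [wt_append, ENNReal.ofReal_add (wt_nonneg _) (wt_nonneg _)]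

lemma mono_inter (G : ℕ → Set (Set ℕ)) (x : Set ℕ) :
    Monotone fun n : ℕ => pre G (x ∩ {k | k ≤ n}) := by
  intro m n h
  exact pre_mono G fun t ht => ⟨ht.1, le_trans ht.2 h⟩

lemma phi_fin (G : ℕ → Set (Set ℕ)) (x : Set ℕ) (n : ℕ) :
    phi G (x ∩ {k | k ≤ n}) = pre G (x ∩ {k | k ≤ n}) := by
  apply le_antisymm
  · exact iSup_le fun m => pre_mono G inter_subset_left
  · refine le_trans ?_ (le_iSup _ n)
    exact pre_mono G fun t ht => ⟨ht, ht.2⟩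

lemma phi_lscsm (G : ℕ → Set (Set ℕ)) : IsLSCSM (phi G) := by
  refine ⟨?_, ?_, ?_⟩
  · have : pre G ∅ = 0 := by
      apply le_antisymm _ zero_le
      refine (iInf₂_le [] ⟨by simp, by simp⟩).trans ?_
      simp [wt]
    simp [phi, this]
  · intro A B
    constructor
    · exact iSup_mono fun n => pre_mono G fun t ht => ⟨Or.inl ht.1, ht.2⟩
    · refine iSup_le fun n => ?_
      rw [union_inter_distrib_right]
      exact (pre_union G _ _).trans (add_le_add (le_iSup (fun n : ℕ => pre G (A ∩ {k | k ≤ n})) n)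
        (le_iSup (fun n : ℕ => pre G (B ∩ {k | k ≤ n})) n))
  · intro A
    simp only [phi_fin]
    exact tendsto_atTop_iSup (mono_inter G A)

lemma lscsm_mono {φ : Set ℕ → ℝ≥0∞} (h : IsLSCSM φ) : Monotone φ := by
  intro A B hAB
  have := (h.2.1 A B).1
  rwa [union_eq_self_of_subset_left hAB] at this

lemma mem_exh {φ : Set ℕ → ℝ≥0∞} (h : IsLSCSM φ) (x : Set ℕ) :
    x ∈ ExhPhi φ ↔ ∀ ε > 0, ∃ n : ℕ, φ (x \ {k | k ≤ n}) ≤ ε := by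
  unfold ExhPhi
  rw [mem_ofPred_eq, ENNReal.tendsto_atTop_zero]
  constructor
  · intro hx ε hε
    obtain ⟨n, hn⟩ := hx ε hε
    exact ⟨n, hn n le_rfl⟩
  · intro hx ε hε
    obtain ⟨n, hn⟩ := hx ε hε
    refine ⟨n, fun m hm => (lscsm_mono h ?_).trans hn⟩
    exact fun t ht => ⟨ht.1, fun h' => ht.2 (le_trans h' hm)⟩

lemma phi_le {G : ℕ → Set (Set ℕ)} {n : ℕ} {x : Set ℕ} (hx : x ∈ G n) :
    phi G x ≤ ENNReal.ofReal ((1 / 2) ^ n) := by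
  refine iSup_le fun m => ?_
  have hmem : (∀ p ∈ [(x, n)], p.1 ∈ G p.2) ∧ x ∩ {k | k ≤ m} ⊆ un [(x, n)] := by
    refine ⟨by simpa using hx, ?_⟩
    intro t ht
    exact ⟨(x, n), by simp, ht.1⟩
  refine (iInf₂_le [(x, n)] hmem).trans ?_
  simp [wt]

lemma mem_of_phi_lt {G : ℕ → Set (Set ℕ)} (hG : ∀ n, Good (G n)) (h0 : ∀ n, ∅ ∈ G n)
    (h3 : ∀ n, ∀ a ∈ G (n + 1), ∀ b ∈ G (n + 1), ∀ c ∈ G (n + 1), a ∪ b ∪ c ∈ G n)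
    {n : ℕ} {x : Set ℕ} (hx : phi G x < ENNReal.ofReal ((1 / 2) ^ n)) : x ∈ G n := by
  apply (hG n).2
  intro N
  have : pre G (x ∩ {k | k ≤ N}) < ENNReal.ofReal ((1 / 2) ^ n) :=
    (le_iSup (fun n : ℕ => pre G (x ∩ {k | k ≤ n})) N).trans_lt hx
  unfold pre at this
  simp only [iInf_lt_iff] at this
  obtain ⟨l, hl, hlt⟩ := this
  have hlt' := (ENNReal.ofReal_lt_ofReal_iff (by positivity)).1 hlt
  refine (hG n).1 _ _ ?_ (key h0 h3 _ l le_rfl hl.1 n hlt')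
  exact fun t ht => hl.2 ⟨ht.1, (le_of_lt ht.2 : t ≤ N)⟩

lemma diff_eq (x : Set ℕ) (n : ℕ) : x \ {k | k ≤ n} = x \ Iio (n + 1) := by
  ext t; simp

theorem forward {I : Set (Set ℕ)} (hI : IsIdeal I) (hfin : ContainsFin I)
    (hA : MeasureTheory.AnalyticSet (chi '' I)) (hP : IsPIdeal I) :
    ∃ φ : Set ℕ → ℝ≥0∞, IsLSCSM φ ∧ I = ExhPhi φ := by
  have hf : ∃ f : (ℕ → ℕ) → Set ℕ, range f = I ∧ Cont f := by
    rw [MeasureTheory.AnalyticSet] at hA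
    rcases hA with h | ⟨g, hg, hr⟩
    · exfalso
      have : chi ∅ ∈ chi '' I := ⟨∅, hI.1, rfl⟩
      rw [h] at this
      exact this
    · have hchi : ∀ A : Set ℕ, {n | chi A n = true} = A := by
        intro A; ext n; simp [chi]
      refine ⟨fun z => {n | g z n = true}, ?_, ?_⟩
      · ext A
        constructor
        · rintro ⟨z, rfl⟩
          have : g z ∈ chi '' I := hr ▸ mem_range_self z
          obtain ⟨B, hB, e⟩ := this
          simp only [← e, hchi]
          exact hB
        · intro hA
          have : chi A ∈ range g := hr ▸ ⟨A, hA, rfl⟩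
          obtain ⟨z, hz⟩ := this
          exact ⟨z, by simp only [hz, hchi]⟩
      · intro z N
        have hopen : IsOpen (g ⁻¹' cylinder (g z) N) :=
          (isOpen_cylinder (fun _ : ℕ => Bool) (g z) N).preimage hg
        have hz : z ∈ g ⁻¹' cylinder (g z) N := self_mem_cylinder _ _
        obtain ⟨s, hs, hzs, hsub⟩ := (isTopologicalBasis_cylinders
          (fun _ : ℕ => ℕ)).exists_subset_of_mem_open hz hopen
        obtain ⟨y, k, rfl⟩ := hs
        refine ⟨k, fun w hw => ?_⟩
        have hw' : w ∈ cylinder y k := fun i hi => (hw i hi).trans (hzs i hi)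
        have := hsub hw'
        ext t
        simp only [mem_inter_iff, mem_ofPred_eq, mem_Iio]
        constructor
        · rintro ⟨a, b⟩
          exact ⟨by rw [← this t b]; exact a, b⟩
        · rintro ⟨a, b⟩
          exact ⟨by rw [this t b]; exact a, b⟩
  obtain ⟨f, hr, hc⟩ := hf
  obtain ⟨G, g, l, h3, h4⟩ := exists_G hI hfin hP hr hc
  have h0 : ∀ n, ∅ ∈ G n := by
    intro n
    obtain ⟨m, hm⟩ := l n ∅ hI.1
    simpa using hm
  refine ⟨phi G, phi_lscsm G, ?_⟩
  ext x
  rw [mem_exh (phi_lscsm G)]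
  constructor
  · intro hx ε hε
    have : ∃ n : ℕ, ENNReal.ofReal ((1 / 2) ^ n) ≤ ε := by
      by_cases ht : ε = ⊤
      · exact ⟨0, by simp [ht]⟩
      obtain ⟨n, hn⟩ := exists_pow_lt_of_lt_one (ENNReal.toReal_pos hε.ne' ht)
        (by norm_num : (1 / 2 : ℝ) < 1)
      exact ⟨n, ENNReal.ofReal_le_of_le_toReal hn.le⟩
    obtain ⟨n, hn⟩ := this
    obtain ⟨m, hm⟩ := l n x hx
    refine ⟨m, (phi_le ((g n).1 _ _ ?_ hm)).trans hn⟩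
    rw [diff_eq]
    exact fun t ht => ⟨ht.1, fun h => ht.2 (lt_trans h (Nat.lt_succ_self m))⟩
  · intro hx
    apply h4
    intro n
    obtain ⟨m, hm⟩ := hx (ENNReal.ofReal ((1 / 2) ^ (n + 1))) (by simp)
    refine ⟨m + 1, mem_of_phi_lt g h0 h3 ?_⟩
    rw [← diff_eq]
    refine hm.trans_lt ?_
    rw [ENNReal.ofReal_lt_ofReal_iff (by positivity)]
    exact pow_lt_pow_right_of_lt_one₀ (by norm_num) (by norm_num) (Nat.lt_succ_self n)

lemma phi_le_of_fin {φ : Set ℕ → ℝ≥0∞} (h : IsLSCSM φ) {x : Set ℕ} {c : ℝ≥0∞}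
    (hx : ∀ n : ℕ, φ (x ∩ {k | k ≤ n}) ≤ c) : φ x ≤ c :=
  le_of_tendsto' (h.2.2 x) hx

theorem fsd {φ : Set ℕ → ℝ≥0∞} (h : IsLSCSM φ) : IsFsigmadelta (chi '' ExhPhi φ) := by
  have hchi : ∀ A : Set ℕ, {n | chi A n = true} = A := by
    intro A; ext n; simp [chi]
  have hchi' : ∀ z : ℕ → Bool, chi {n | z n = true} = z := by
    intro z; ext n; simp [chi]
  refine ⟨fun q => ⋃ n : ℕ, {z | φ ({k | z k = true} \ {k | k ≤ n}) ≤ ((q : ℝ≥0∞))⁻¹},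
    fun q => ⟨_, fun n => ?_, rfl⟩, ?_⟩
  · have : {z : ℕ → Bool | φ ({k | z k = true} \ {k | k ≤ n}) ≤ ((q : ℝ≥0∞))⁻¹} =
        ⋂ m : ℕ, {z | φ (({k | z k = true} \ {k | k ≤ n}) ∩ {k | k ≤ m}) ≤ ((q : ℝ≥0∞))⁻¹} := by
      ext z
      simp only [mem_ofPred_eq, mem_iInter]
      exact ⟨fun hz m => (lscsm_mono h inter_subset_left).trans hz, fun hz => phi_le_of_fin h hz⟩
    rw [this]
    refine isClosed_iInter fun m => ?_
    rw [← isOpen_compl_iff, isOpen_iff_mem_nhds]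
    intro z hz
    refine mem_of_superset ((isOpen_cylinder (fun _ : ℕ => Bool) z (m + 1)).mem_nhds
      (self_mem_cylinder z (m + 1))) ?_
    intro w hw
    simp only [mem_compl_iff, mem_ofPred_eq] at hz ⊢
    have heq : ({k | w k = true} \ {k | k ≤ n}) ∩ {k | k ≤ m} =
        ({k | z k = true} \ {k | k ≤ n}) ∩ {k | k ≤ m} := ?_
    · rwa [heq]
    ext t
    simp only [mem_inter_iff, Set.mem_sdiff, mem_ofPred_eq]
    constructor
    · rintro ⟨⟨a, b⟩, c⟩
      exact ⟨⟨by rw [← hw t (by omega)]; exact a, b⟩, c⟩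
    · rintro ⟨⟨a, b⟩, c⟩
      exact ⟨⟨by rw [hw t (by omega)]; exact a, b⟩, c⟩
  · ext z
    have : z ∈ chi '' ExhPhi φ ↔ {k | z k = true} ∈ ExhPhi φ := by
      constructor
      · rintro ⟨A, hA, rfl⟩
        rwa [hchi]
      · intro hz
        exact ⟨_, hz, hchi' z⟩
    rw [this, mem_exh h]
    simp only [mem_iInter, mem_iUnion, mem_ofPred_eq]
    constructor
    · intro hz q
      exact hz _ (by simp)
    · intro hz ε hε
      obtain ⟨q, hq⟩ := ENNReal.exists_inv_nat_lt hε.ne'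
      obtain ⟨n, hn⟩ := hz q
      exact ⟨n, hn.trans hq.le⟩

lemma sub_finset {φ : Set ℕ → ℝ≥0∞} (h : IsLSCSM φ) (D : ℕ → Set ℕ) (N : ℕ) :
    φ {t | ∃ i < N, t ∈ D i} ≤ ∑ i ∈ Finset.range N, φ (D i) := by
  induction N with
  | zero => simp [h.1]
  | succ N ih =>
    rw [Finset.sum_range_succ]
    refine le_trans (lscsm_mono h ?_) ((h.2.1 _ _).2.trans (add_le_add ih le_rfl))
    rintro t ⟨i, hi, ht⟩
    rcases Nat.lt_succ_iff_lt_or_eq.1 hi with h | rfl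
    · exact Or.inl ⟨i, h, ht⟩
    · exact Or.inr ht

lemma sub_count {φ : Set ℕ → ℝ≥0∞} (h : IsLSCSM φ) (D : ℕ → Set ℕ) :
    φ (⋃ i, D i) ≤ ∑' i, φ (D i) := by
  apply phi_le_of_fin h
  intro n
  have hfin : ∀ k : ℕ, ∃ N, ∀ t ≤ k, t ∈ (⋃ i, D i) → ∃ i < N, t ∈ D i := by
    have : ∀ t : ℕ, ∃ i, t ∈ (⋃ i, D i) → t ∈ D i := by
      intro t
      by_cases ht : t ∈ ⋃ i, D i
      · obtain ⟨i, hi⟩ := mem_iUnion.1 ht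
        exact ⟨i, fun _ => hi⟩
      · exact ⟨0, fun h => absurd h ht⟩
    choose j hj using this
    intro k
    refine ⟨(Finset.range (k + 1)).sup j + 1, fun t ht h => ⟨j t, ?_, hj t h⟩⟩
    exact Nat.lt_succ_of_le (Finset.le_sup (f := j) (by simp; omega))
  obtain ⟨N, hN⟩ := hfin n
  refine (lscsm_mono h ?_).trans ((sub_finset h D N).trans (ENNReal.sum_le_tsum _))
  exact fun t ht => hN t ht.2 ht.1

lemma tsum_split (u : ℕ → ℝ≥0∞) (N : ℕ) :
    ∑' n, u n = ∑ n ∈ Finset.range N, u n + ∑' n, u (n + N) :=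
  (Summable.sum_add_tsum_nat_add' (f := u) (k := N) ENNReal.summable).symm

theorem backward {φ : Set ℕ → ℝ≥0∞} (h : IsLSCSM φ) : IsPIdeal (ExhPhi φ) := by
  intro E hE
  obtain ⟨δ, hδ, hsum⟩ := ENNReal.exists_pos_sum_of_countable' (ε := 1) one_ne_zero ℕ
  have : ∀ n, ∃ m : ℕ, φ (E n \ {k | k ≤ m}) ≤ δ n := fun n => (mem_exh h _).1 (hE n) _ (hδ n)
  choose m hm using this
  refine ⟨⋃ n, E n \ {k | k ≤ m n}, ?_, ?_⟩
  · show Tendsto _ _ _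
    have hle : ∀ k : ℕ, φ ((⋃ n, E n \ {k | k ≤ m n}) \ {j | j ≤ k}) ≤
        ∑' n, φ ((E n \ {k | k ≤ m n}) \ {j | j ≤ k}) := by
      intro k
      rw [iUnion_sdiff]
      exact sub_count h _
    refine tendsto_of_tendsto_of_tendsto_of_le_of_le tendsto_const_nhds ?_
      (fun _ => zero_le) hle
    have hfin : ∑' n, δ n ≠ ⊤ := (hsum.trans ENNReal.one_lt_top).ne
    rw [ENNReal.tendsto_atTop_zero]
    intro ε hε
    obtain ⟨ε', hε', hlt⟩ : ∃ ε', 0 < ε' ∧ ε' + ε' ≤ ε :=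
      ⟨ε / 2, ENNReal.half_pos hε.ne', (ENNReal.add_halves ε).le⟩
    have htail := ENNReal.tendsto_sum_nat_add δ hfin
    rw [ENNReal.tendsto_atTop_zero] at htail
    obtain ⟨N, hN⟩ := htail ε' hε'
    have hfirst : Tendsto (fun k : ℕ => ∑ n ∈ Finset.range N,
        φ ((E n \ {k | k ≤ m n}) \ {j | j ≤ k})) atTop (𝓝 0) := by
      rw [← Finset.sum_const_zero (s := Finset.range N)]
      refine tendsto_finsetSum _ fun n _ => ?_
      refine tendsto_of_tendsto_of_tendsto_of_le_of_le tendsto_const_nhds (hE n)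
        (fun _ => zero_le) fun k => lscsm_mono h ?_
      exact fun t ht => ⟨ht.1.1, ht.2⟩
    rw [ENNReal.tendsto_atTop_zero] at hfirst
    obtain ⟨M, hM⟩ := hfirst ε' hε'
    refine ⟨M, fun k hk => ?_⟩
    rw [tsum_split (fun n => φ ((E n \ {k | k ≤ m n}) \ {j | j ≤ k})) N]
    refine le_trans (add_le_add (hM k hk) ?_) hlt
    have hterm : ∀ n, φ ((E n \ {k | k ≤ m n}) \ {j | j ≤ k}) ≤ δ n :=
      fun n => (lscsm_mono h sdiff_subset).trans (hm n)
    exact le_trans (ENNReal.tsum_le_tsum fun n => hterm (n + N)) (hN N le_rfl)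
  · intro n
    refine (finite_Iic (m n)).subset ?_
    rintro t ⟨ht, h'⟩
    by_contra hc
    exact h' (mem_iUnion.2 ⟨n, ht, hc⟩)

end SoleckiProof

/-- Solecki: an analytic ideal is a P-ideal iff it is `Exh(φ)` for some lscsm `φ`;
in particular every analytic P-ideal is `Fσδ`. -/
theorem solecki (I : Set (Set ℕ)) (hI : IsIdeal I) (hfin : ContainsFin I)
    (hA : MeasureTheory.AnalyticSet (chi '' I)) :
    (IsPIdeal I ↔ ∃ φ : Set ℕ → ℝ≥0∞, IsLSCSM φ ∧ I = ExhPhi φ) ∧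
    (IsPIdeal I → IsFsigmadelta (chi '' I)) := by
  refine ⟨⟨SoleckiProof.forward hI hfin hA, ?_⟩, fun hP => ?_⟩
  · rintro ⟨φ, h, rfl⟩
    exact SoleckiProof.backward h
  · obtain ⟨φ, h, rfl⟩ := SoleckiProof.forward hI hfin hA hP
    exact SoleckiProof.fsd h
end

section
/- (Hrušák; Category Dichotomy) Let I be a Borel ideal on ℕ containing all finite sets. Then either I ≤_K nwd(ℚ), or there is an I-positive set X ⊆ ℕ such that ED ≤_K I↾X. -/
open Set Filter Topology

/-- Katětov order. -/
def KatetovLE {X Y : Type*} (I : Set (Set X)) (J : Set (Set Y)) : Prop :=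
  ∃ f : Y → X, ∀ E ∈ I, f ⁻¹' E ∈ J

/-- The ideal `nwd(ℚ)` of nowhere dense subsets of `ℚ`. -/
def nwdQ : Set (Set ℚ) := {A : Set ℚ | IsNowhereDense A}

/-- The eventually different ideal `ED` on `ℕ × ℕ`. -/
def ED : Set (Set (ℕ × ℕ)) :=
  {A : Set (ℕ × ℕ) | ∃ n : ℕ, ∀ m ≥ n, {k : ℕ | (m, k) ∈ A}.encard ≤ (n : ℕ∞)}

/-- Restriction of an ideal `I` to an `I`-positive set `X`, as an ideal on `↥X`. -/
def restrictIdeal {Z : Type*} (I : Set (Set Z)) (X : Set Z) : Set (Set ↥X) :=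
  {A : Set ↥X | ((↑) '' A : Set Z) ∈ I}


/-- Local selectivity. -/
def LocSel (I : Set (Set ℕ)) : Prop :=
  ∀ X : Set ℕ, X ∉ I → ∀ h : ℕ → ℕ, (∀ k, X ∩ h ⁻¹' {k} ∈ I) →
    ∃ S ⊆ X, S ∉ I ∧ Set.InjOn h S

lemma fibres_mem (I : Set (Set ℕ)) (hI : IsIdeal I) (X : Set ℕ) (h : ℕ → ℕ)
    (hs : ∀ S ⊆ X, Set.InjOn h S → S ∈ I) (n : ℕ) :
    ∀ R ⊆ X, (∀ m, (R ∩ h ⁻¹' {m}).encard ≤ (n : ℕ∞)) → R ∈ I := by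
  induction n with
  | zero =>
    intro R hR hm
    have : R = ∅ := by
      ext x
      simp only [Set.mem_empty_iff_false, iff_false]
      intro hx
      have := hm (h x)
      simp only [Nat.cast_zero, nonpos_iff_eq_zero, Set.encard_eq_zero] at this
      have hx' : x ∈ R ∩ h ⁻¹' {h x} := ⟨hx, rfl⟩
      rw [this] at hx'
      exact hx'
    rw [this]; exact hI.1
  | succ n ih =>
    intro R hR hm
    let R' : Set ℕ := {x ∈ R | ∀ y ∈ R, h y = h x → x ≤ y}
    have h1 : R' ∈ I := by
      apply hs R' (fun x hx => hR hx.1)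
      intro x hx y hy hxy
      exact le_antisymm (hx.2 y hy.1 hxy.symm) (hy.2 x hx.1 hxy)
    have h2 : R \ R' ∈ I := by
      apply ih _ (fun x hx => hR hx.1)
      intro m
      by_cases hne : (R ∩ h ⁻¹' {m}).Nonempty
      · classical
        have hmem := Nat.sInf_mem hne
        set a := sInf (R ∩ h ⁻¹' {m}) with ha
        have haR' : a ∈ R' := by
          refine ⟨hmem.1, fun y hy hya => Nat.sInf_le ⟨hy, ?_⟩⟩
          have : h a = m := hmem.2
          simp [hya, this]
        have hsub : insert a ((R \ R') ∩ h ⁻¹' {m}) ⊆ R ∩ h ⁻¹' {m} := by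
          rintro x (rfl | hx)
          · exact hmem
          · exact ⟨hx.1.1, hx.2⟩
        have hna : a ∉ (R \ R') ∩ h ⁻¹' {m} := fun hx => hx.1.2 haR'
        have := (Set.encard_le_encard hsub).trans (hm m)
        rw [Set.encard_insert_of_notMem hna] at this
        push_cast at this
        exact (ENat.add_le_add_iff_right (by simp)).1 this
      · have : (R \ R') ∩ h ⁻¹' {m} = ∅ := by
          ext x
          simp only [Set.mem_empty_iff_false, iff_false]
          intro hx
          exact hne ⟨x, hx.1.1, hx.2⟩
        rw [this]; simp
    have := hI.2.2.1 _ _ h1 h2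
    refine hI.2.2.2 _ _ ?_ this
    intro x hx
    by_cases hx' : x ∈ R'
    · exact Or.inl hx'
    · exact Or.inr ⟨hx, hx'⟩

lemma biUnion_mem {ι : Type*} (I : Set (Set ℕ)) (hI : IsIdeal I) (s : Set ι) (hs : s.Finite)
    (A : ι → Set ℕ) (hA : ∀ i ∈ s, A i ∈ I) : (⋃ i ∈ s, A i) ∈ I := by
  induction s, hs using Set.Finite.induction_on with
  | empty => simpa using hI.1
  | insert _ _ ih =>
    rw [Set.biUnion_insert]
    exact hI.2.2.1 _ _ (hA _ (Set.mem_insert _ _)) (ih fun i hi => hA i (Set.mem_insert_of_mem _ hi))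

lemma locSel_of_not (I : Set (Set ℕ)) (hI : IsIdeal I)
    (hED : ¬ ∃ X : Set ℕ, X ∉ I ∧ KatetovLE ED (restrictIdeal I X)) : LocSel I := by
  intro X hX h hfib
  by_contra hcon
  push Not at hcon
  have hs : ∀ S ⊆ X, Set.InjOn h S → S ∈ I := by
    intro S hS hinj
    by_contra hSI
    exact hcon S hS hSI hinj
  refine hED ⟨X, hX, fun x => (h x, x), ?_⟩
  rintro E ⟨n, hn⟩
  change ((↑) '' ((fun x : X => (h x, (x : ℕ))) ⁻¹' E) : Set ℕ) ∈ I
  have h1 : (⋃ k ∈ Set.Iio n, X ∩ h ⁻¹' {k}) ∈ I :=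
    biUnion_mem I hI _ (Set.finite_Iio n) _ (fun k _ => hfib k)
  have h2 : {x ∈ X | n ≤ h x ∧ (h x, x) ∈ E} ∈ I := by
    apply fibres_mem I hI X h hs n _ (fun x hx => hx.1)
    intro m
    by_cases hm : n ≤ m
    · refine le_trans (Set.encard_le_encard ?_) (hn m hm)
      rintro x ⟨⟨_, _, hx⟩, hxm⟩
      have : h x = m := hxm
      rw [this] at hx
      exact hx
    · have : {x ∈ X | n ≤ h x ∧ (h x, x) ∈ E} ∩ h ⁻¹' {m} = ∅ := by
        ext x
        simp only [Set.mem_empty_iff_false, iff_false]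
        rintro ⟨⟨_, hx, _⟩, hxm⟩
        have : h x = m := hxm
        omega
      rw [this]; simp
  refine hI.2.2.2 _ _ ?_ (hI.2.2.1 _ _ h1 h2)
  rintro _ ⟨x, hx, rfl⟩
  by_cases hxn : n ≤ h x
  · exact Or.inr ⟨x.2, hxn, hx⟩
  · left
    simp only [Set.mem_iUnion]
    exact ⟨h x, not_le.1 hxn, x.2, rfl⟩

/-- Against any assignment of ideal sets to histories, there is a positive run. -/
lemma positive_run (I : Set (Set ℕ)) (hI : IsIdeal I) (hfin : ContainsFin I) (hsel : LocSel I)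
    (X : Set ℕ) (hX : X ∉ I) (A : List ℕ → Set ℕ) (hA : ∀ s, A s ∈ I) :
    ∃ n : ℕ → ℕ, (∀ k, n k ∈ X) ∧ (∀ k, n k ∉ A ((List.range k).map n)) ∧ Set.range n ∉ I := by
  classical
  let L : ℕ → Set (List ℕ) := fun k => {s | s.length ≤ k ∧ ∀ x ∈ s, x < k}
  have hL : ∀ k, (L k).Finite := by
    intro k
    have hf := List.finite_length_le (Fin k) k
    refine (hf.image (List.map Fin.val)).subset ?_
    rintro s ⟨hs1, hs2⟩
    refine ⟨s.pmap (fun x hx => (⟨x, hx⟩ : Fin k)) hs2, by simpa using hs1, ?_⟩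
    simp [List.map_pmap]
  let B : ℕ → Set ℕ := fun k => Set.Iio k ∪ ⋃ s ∈ L k, A s
  have hB : ∀ k, B k ∈ I := fun k =>
    hI.2.2.1 _ _ (hfin _ (Set.finite_Iio k)) (biUnion_mem I hI _ (hL k) _ (fun s _ => hA s))
  have hBmono : Monotone B := by
    intro a b hab x hx
    rcases hx with hx | hx
    · exact Or.inl (lt_of_lt_of_le hx hab)
    · right
      simp only [Set.mem_iUnion] at hx ⊢
      obtain ⟨s, hs, hx⟩ := hx
      exact ⟨s, ⟨hs.1.trans hab, fun y hy => (hs.2 y hy).trans_le hab⟩, hx⟩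
  have hBex : ∀ x, ∃ k, x ∈ B k := fun x => ⟨x + 1, Or.inl (Nat.lt_succ_self x)⟩
  let c : ℕ → ℕ := fun x => Nat.find (hBex x)
  have hc : ∀ x, x ∈ B (c x) := fun x => Nat.find_spec (hBex x)
  have hc' : ∀ x k, k < c x → x ∉ B k := fun x k hk => Nat.find_min (hBex x) hk
  obtain ⟨S, hSX, hSI, hSinj⟩ := hsel X hX c (fun k => hI.2.2.2 _ _ (by
    rintro x ⟨_, hx⟩
    have : c x = k := hx
    rw [← this]; exact hc x) (hB k))
  -- finiteness
  have hfinS : ∀ m, {y ∈ S | c y ≤ m}.Finite := by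
    intro m
    refine Set.Finite.of_finite_image ((Set.finite_Iic m).subset ?_) (hSinj.mono fun x hx => hx.1)
    rintro _ ⟨x, hx, rfl⟩
    exact hx.2
  have hbd : ∀ m, ∃ M, m < M ∧ ∀ y ∈ S, c y ≤ m + 1 → y ≤ M := by
    intro m
    obtain ⟨M, hM⟩ := (hfinS (m + 1)).bddAbove
    exact ⟨max M (m + 1), by omega, fun y hy hcy => le_max_of_le_left (hM ⟨hy, hcy⟩)⟩
  choose g hg1 hg2 using hbd
  let m : ℕ → ℕ := fun i => g^[i] 0
  have hms : ∀ i, m (i + 1) = g (m i) := fun i => Function.iterate_succ_apply' g i 0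
  have hmm : StrictMono m := strictMono_nat_of_lt_succ fun i => by rw [hms]; exact hg1 _
  have hdex : ∀ x, ∃ i, x ≤ m i := fun x => ⟨x, hmm.id_le x⟩
  let d : ℕ → ℕ := fun x => Nat.find (hdex x)
  have hd : ∀ x, x ≤ m (d x) := fun x => Nat.find_spec (hdex x)
  have hd' : ∀ x k, k < d x → m k < x := fun x k hk => not_le.1 (Nat.find_min (hdex x) hk)
  have hdmono : Monotone d := by
    intro x y hxy
    exact Nat.find_min' _ (hxy.trans (hd y))
  obtain ⟨S', hS'S, hS'I, hS'inj⟩ := hsel S hSI d (fun k => hfin _ ((Set.finite_Iic (m k)).subset (by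
    rintro x ⟨_, hx⟩
    have : d x = k := hx
    rw [← this]; exact hd x)))
  obtain ⟨r, hr⟩ : ∃ r : ℕ, {x ∈ S' | d x % 2 = r} ∉ I := by
    by_contra hcon
    push Not at hcon
    refine hS'I (hI.2.2.2 _ _ ?_ (hI.2.2.1 _ _ (hcon 0) (hcon 1)))
    intro x hx
    rcases Nat.mod_two_eq_zero_or_one (d x) with h | h
    · exact Or.inl ⟨hx, h⟩
    · exact Or.inr ⟨hx, h⟩
  let Z : Set ℕ := {x ∈ S' | d x % 2 = r} \ B 0
  have hZ : Z ∉ I := by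
    intro hZ
    refine hr (hI.2.2.2 _ _ ?_ (hI.2.2.1 _ _ hZ (hB 0)))
    intro x hx
    by_cases hx' : x ∈ B 0
    · exact Or.inr hx'
    · exact Or.inl ⟨hx, hx'⟩
  have hZS : ∀ x ∈ Z, x ∈ S := fun x hx => hS'S hx.1.1
  have hkey : ∀ x ∈ Z, ∀ y ∈ Z, x < y → y ∉ B (x + 1) := by
    intro x hx y hy hxy
    have h1 : d x ≤ d y := hdmono hxy.le
    have h2 : d x ≠ d y := fun h => hxy.ne (hS'inj hx.1.1 hy.1.1 h)
    have h3 : d x % 2 = r := hx.1.2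
    have h4 : d y % 2 = r := hy.1.2
    have h5 : d x + 1 < d y := by omega
    have h6 := hd' y _ h5
    rw [hms] at h6
    apply hc'
    by_contra h7
    have h8 := hg2 (m (d x)) y (hZS y hy) (by have := hd x; omega)
    omega
  have hZinf : Z.Infinite := fun hf => hZ (hfin _ hf)
  have hnth : ∀ k, Nat.nth (· ∈ Z) k ∈ Z := fun k => Nat.nth_mem_of_infinite hZinf k
  have hnm : StrictMono (Nat.nth (· ∈ Z)) := Nat.nth_strictMono hZinf
  refine ⟨Nat.nth (· ∈ Z), fun k => hSX (hZS _ (hnth k)), ?_, ?_⟩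
  · intro k hk
    rcases k with _ | k
    · refine (hnth 0).2 (Or.inr ?_)
      simp only [Set.mem_iUnion]
      exact ⟨[], ⟨by simp, by simp⟩, by simpa using hk⟩
    · refine hkey _ (hnth k) _ (hnth (k + 1)) (hnm (Nat.lt_succ_self k)) (Or.inr ?_)
      simp only [Set.mem_iUnion]
      refine ⟨_, ⟨?_, ?_⟩, hk⟩
      · have := hnm.id_le k
        simp only [List.length_map, List.length_range]
        simp only [id] at this
        omega
      · intro x hx
        simp only [List.mem_map, List.mem_range] at hx
        obtain ⟨a, ha, rfl⟩ := hx
        have := hnm.monotone (show a ≤ k by omega)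
        omega
  · have h := Nat.range_nth_of_infinite (p := (· ∈ Z)) hZinf
    rw [h]
    exact hZ

/-- `y` extends the finite sequence `v`. -/
def ExtSeq (y : ℕ → ℕ) (v : List ℕ) : Prop := v = (List.range v.length).map y

lemma ext_succ (y : ℕ → ℕ) (v : List ℕ) (h : ExtSeq y v) : ExtSeq y (v ++ [y v.length]) := by
  unfold ExtSeq at *
  rw [List.length_append, List.length_singleton, List.range_succ, List.map_append, ← h]
  simp

/-- Positions won by the second player in the unfolded game on `X`. -/
inductive WinII (I : Set (Set ℕ)) (f : (ℕ → ℕ) → ℕ → Bool) (X : Set ℕ) :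
    List ℕ → List ℕ → Prop
  | bad (F v : List ℕ) (n : ℕ) (hn : n ∈ F) (h : ∀ y, ExtSeq y v → f y n = false) : WinII I f X F v
  | step (F v : List ℕ) (Q : ℕ → Set ℕ) (hQX : ∀ j, Q j ⊆ X) (hQ : ∀ j, Q j ∉ I)
      (h : ∀ j, ∀ n ∈ Q j, WinII I f X (F ++ [n]) (v ++ [j])) : WinII I f X F v

/-- Answer sets. -/
def Ans (I : Set (Set ℕ)) (f : (ℕ → ℕ) → ℕ → Bool) (X : Set ℕ) (F v : List ℕ) (j : ℕ) : Set ℕ :=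
  {n ∈ X | WinII I f X (F ++ [n]) (v ++ [j])}

lemma win_countable (I : Set (Set ℕ)) (f : (ℕ → ℕ) → ℕ → Bool) (X : Set ℕ)
    (F v : List ℕ) (hw : WinII I f X F v) :
    ∃ PP : Set (Set ℕ), PP.Countable ∧ (∀ P ∈ PP, P ⊆ X ∧ P ∉ I) ∧
      ∀ y, ExtSeq y v → (∀ n ∈ F, f y n = true) → ∃ P ∈ PP, ∀ n ∈ P, f y n = false := by
  induction hw with
  | bad F v n hn h =>
    refine ⟨∅, Set.countable_empty, by simp, fun y hy hF => ?_⟩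
    have h1 := h y hy
    rw [hF n hn] at h1
    exact absurd h1 (by simp)
  | step F v Q hQX hQ h ih =>
    choose! PP hc hp hy using ih
    refine ⟨Set.range Q ∪ ⋃ j, ⋃ n ∈ Q j, PP j n, ?_, ?_, ?_⟩
    · refine (Set.countable_range Q).union (Set.countable_iUnion fun j => ?_)
      exact (Set.to_countable (Q j)).biUnion fun n hn => hc j n hn
    · rintro P (⟨j, rfl⟩ | hP)
      · exact ⟨hQX j, hQ j⟩
      · simp only [Set.mem_iUnion] at hP
        obtain ⟨j, n, hn, hP⟩ := hP
        exact hp j n hn P hP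
    · intro y hyv hF
      by_cases hcase : ∀ n ∈ Q (y v.length), f y n = false
      · exact ⟨_, Or.inl ⟨_, rfl⟩, hcase⟩
      · push Not at hcase
        obtain ⟨n, hn, hfn⟩ := hcase
        obtain ⟨P, hP, hPd⟩ := hy (y v.length) n hn y (ext_succ y v hyv) (by
          intro k hk
          rcases List.mem_append.1 hk with hk | hk
          · exact hF k hk
          · rw [List.mem_singleton.1 hk]; simpa using hfn)
        refine ⟨P, Or.inr ?_, hPd⟩
        simp only [Set.mem_iUnion]
        exact ⟨_, n, hn, hP⟩

lemma win_family (I : Set (Set ℕ)) (hI : IsIdeal I) (f : (ℕ → ℕ) → ℕ → Bool)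
    (hf : Set.range f = chi '' I) (X : Set ℕ) (hw : WinII I f X [] []) :
    ∃ P : ℕ → Set ℕ, (∀ i, P i ⊆ X) ∧ (∀ i, P i ∉ I) ∧ ∀ E ∈ I, ∃ i, P i ∩ E = ∅ := by
  obtain ⟨PP, hc, hp, hy⟩ := win_countable I f X [] [] hw
  have key : ∀ E ∈ I, ∃ P ∈ PP, P ∩ E = ∅ := by
    intro E hE
    obtain ⟨y, hyE⟩ : chi E ∈ Set.range f := by rw [hf]; exact ⟨E, hE, rfl⟩
    obtain ⟨P, hP, hd⟩ := hy y rfl (by simp)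
    refine ⟨P, hP, ?_⟩
    ext n
    simp only [Set.mem_inter_iff, Set.mem_empty_iff_false, iff_false, not_and]
    intro hn
    have := hd n hn
    rw [hyE] at this
    simpa [chi] using this
  have hne : PP.Nonempty := by
    obtain ⟨P, hP, _⟩ := key ∅ hI.1
    exact ⟨P, hP⟩
  obtain ⟨e, he⟩ := hc.exists_eq_range hne
  refine ⟨e, fun i => (hp (e i) (he ▸ ⟨i, rfl⟩)).1, fun i => (hp (e i) (he ▸ ⟨i, rfl⟩)).2, ?_⟩
  intro E hE
  obtain ⟨P, hP, h⟩ := key E hE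
  rw [he] at hP
  obtain ⟨i, rfl⟩ := hP
  exact ⟨i, h⟩

lemma not_win_strategy (I : Set (Set ℕ)) (hI : IsIdeal I) (f : (ℕ → ℕ) → ℕ → Bool)
    (hfc : Continuous f)
    (hf : Set.range f = chi '' I) (X : Set ℕ) (hw : ¬ WinII I f X [] []) :
    ∃ A : List ℕ → Set ℕ, (∀ s, A s ∈ I) ∧ ∀ n : ℕ → ℕ, (∀ k, n k ∈ X) →
      (∀ k, n k ∉ A ((List.range k).map n)) → Set.range n ∈ I := by
  classical
  have hex : ∀ F v : List ℕ, ∃ j, ¬ WinII I f X F v → Ans I f X F v j ∈ I := by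
    intro F v
    by_cases h : WinII I f X F v
    · exact ⟨0, fun h' => absurd h h'⟩
    · by_contra hcon
      push Not at hcon
      exact h (WinII.step F v (fun j => Ans I f X F v j) (fun j n hn => hn.1)
        (fun j => (hcon j).2) (fun j n hn => hn.2))
  choose J hJ using hex
  -- the witness moves along a history
  let V : List ℕ → List ℕ := fun s =>
    (s.foldl (fun p n => (p.1 ++ [n], p.2 ++ [J p.1 p.2])) (([], []) : List ℕ × List ℕ)).2
  have hfst : ∀ s : List ℕ,
      (s.foldl (fun p n => (p.1 ++ [n], p.2 ++ [J p.1 p.2])) (([], []) : List ℕ × List ℕ)).1 = s := by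
    intro s
    induction s using List.reverseRecOn with
    | nil => rfl
    | append_singleton s a ih => simp [List.foldl_append, ih]
  have hV : ∀ s a, V (s ++ [a]) = V s ++ [J s (V s)] := by
    intro s a
    simp only [V, List.foldl_append, List.foldl_cons, List.foldl_nil, hfst]
  refine ⟨fun s => if Ans I f X s (V s) (J s (V s)) ∈ I then Ans I f X s (V s) (J s (V s)) else ∅,
    ?_, ?_⟩
  · intro s
    dsimp only
    split_ifs with h
    · exact h
    · exact hI.1
  · intro n hnX hnA
    let s : ℕ → List ℕ := fun k => (List.range k).map n
    have hs : ∀ k, s (k + 1) = s k ++ [n k] := by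
      intro k; simp [s, List.range_succ]
    have hnw : ∀ k, ¬ WinII I f X (s k) (V (s k)) := by
      intro k
      induction k with
      | zero => exact hw
      | succ k ih =>
        have h1 := hJ _ _ ih
        have h2 : n k ∉ if Ans I f X (s k) (V (s k)) (J (s k) (V (s k))) ∈ I then
            Ans I f X (s k) (V (s k)) (J (s k) (V (s k))) else ∅ := hnA k
        rw [if_pos h1] at h2
        intro h3
        rw [hs, hV] at h3
        exact h2 ⟨hnX k, h3⟩
    let y : ℕ → ℕ := fun k => J (s k) (V (s k))
    have hVy : ∀ k, V (s k) = (List.range k).map y := by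
      intro k
      induction k with
      | zero => rfl
      | succ k ih => rw [hs, hV, List.range_succ, List.map_append, ← ih]; rfl
    have hall : ∀ k, f y (n k) = true := by
      intro k
      by_contra hk
      have hk' : f y (n k) = false := by simpa using hk
      have hcont : Continuous fun z => f z (n k) := (continuous_apply (n k)).comp hfc
      have hopen : IsOpen {z | f z (n k) = false} :=
        (isOpen_discrete ({false} : Set Bool)).preimage hcont
      obtain ⟨l, hl⟩ : ∃ l, ∀ z : ℕ → ℕ, (∀ i < l, z i = y i) → f z (n k) = false := by
        obtain ⟨T, u, hu, hsub⟩ := isOpen_pi_iff.1 hopen y hk'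
        refine ⟨T.sup (· + 1), fun z hz => hsub ?_⟩
        intro i hi
        have hi' : i + 1 ≤ T.sup (· + 1) := Finset.le_sup (f := (· + 1)) hi
        rw [hz i (by omega)]
        exact (hu i hi).2
      refine hnw (max l (k + 1)) (WinII.bad _ _ (n k) ?_ ?_)
      · simp only [s, List.mem_map, List.mem_range]
        exact ⟨k, by omega, rfl⟩
      · intro z hz
        apply hl
        intro i hi
        rw [hVy] at hz
        unfold ExtSeq at hz
        simp only [List.length_map, List.length_range] at hz
        have := List.map_inj_left.1 hz i (by simp; omega)
        exact this.symm
    have : f y ∈ chi '' I := by rw [← hf]; exact ⟨y, rfl⟩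
    obtain ⟨E, hE, hEy⟩ := this
    refine hI.2.2.2 _ _ ?_ hE
    rintro _ ⟨k, rfl⟩
    have := hall k
    rw [← hEy] at this
    simpa [chi] using this

/-- Eventually zero integer sequences, ordered lexicographically. -/
abbrev DD : Type := Lex (ℕ →₀ ℤ)

lemma dd_lt (a b : DD) :
    a < b ↔ ∃ i, (∀ j, j < i → ofLex a j = ofLex b j) ∧ ofLex a i < ofLex b i :=
  Finsupp.Lex.lt_iff

/-- Bump one coordinate. -/
noncomputable def bump (a : DD) (i : ℕ) (z : ℤ) : DD := toLex (ofLex a + Finsupp.single i z)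

lemma bump_ne (a : DD) (i : ℕ) (z : ℤ) (j : ℕ) (h : j ≠ i) : ofLex (bump a i z) j = ofLex a j := by
  simp [bump, Finsupp.single_apply, h.symm]

lemma bump_eq (a : DD) (i : ℕ) (z : ℤ) : ofLex (bump a i z) i = ofLex a i + z := by
  simp [bump]

lemma lt_bump (a : DD) (i : ℕ) : a < bump a i 1 :=
  (dd_lt _ _).2 ⟨i, fun j hj => (bump_ne a i 1 j hj.ne).symm, by rw [bump_eq]; omega⟩

lemma bump_lt (a : DD) (i : ℕ) : bump a i (-1) < a :=
  (dd_lt _ _).2 ⟨i, fun j hj => (bump_ne a i (-1) j hj.ne), by rw [bump_eq]; omega⟩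

lemma cone_in (a b : DD) (h : a < b) :
    ∃ u : DD, ∃ m : ℕ, ∀ x : DD, (∀ j < m, ofLex x j = ofLex u j) → a < x ∧ x < b := by
  obtain ⟨i, h1, h2⟩ := (dd_lt a b).1 h
  refine ⟨bump a (i + 1) 1, i + 2, fun x hx => ⟨?_, ?_⟩⟩
  · refine (dd_lt _ _).2 ⟨i + 1, fun j hj => ?_, ?_⟩
    · rw [hx j (by omega), bump_ne _ _ _ _ (by omega)]
    · rw [hx _ (by omega), bump_eq]; omega
  · refine (dd_lt _ _).2 ⟨i, fun j hj => ?_, ?_⟩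
    · rw [hx j (by omega), bump_ne _ _ _ _ (by omega)]; exact h1 j hj
    · rw [hx _ (by omega), bump_ne _ _ _ _ (by omega)]; exact h2

lemma cone_out (t : DD) (m : ℕ) (x : DD) (h1 : t < x) (h2 : x < bump t m 1) :
    ∀ j < m, ofLex x j = ofLex t j := by
  obtain ⟨i, hi1, hi2⟩ := (dd_lt _ _).1 h1
  obtain ⟨k, hk1, hk2⟩ := (dd_lt _ _).1 h2
  by_cases him : m ≤ i
  · intro j hj
    exact (hi1 j (by omega)).symm
  · exfalso
    rcases lt_trichotomy k i with h | h | h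
    · rw [bump_ne _ _ _ _ (by omega)] at hk2
      have := hi1 k h
      omega
    · subst h
      rw [bump_ne _ _ _ _ (by omega)] at hk2
      omega
    · have := hk1 i h
      rw [bump_ne _ _ _ _ (by omega)] at this
      omega

instance : DenselyOrdered DD := ⟨fun a b h => by
  obtain ⟨u, m, hu⟩ := cone_in a b h
  exact ⟨u, hu u fun _ _ => rfl⟩⟩

instance : NoMaxOrder DD := ⟨fun a => ⟨_, lt_bump a 0⟩⟩

instance : NoMinOrder DD := ⟨fun a => ⟨_, bump_lt a 0⟩⟩

instance : Countable DD := inferInstanceAs (Countable (ℕ →₀ ℤ))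

instance : Nonempty DD := ⟨toLex 0⟩

/-- The positive set attached to the first `k` coordinates of `x`. -/
def nodeSet {α : Type*} (r : α) (P : α → ℕ → α) (x : DD) : ℕ → α
  | 0 => r
  | k + 1 => P (nodeSet r P x k) ((ofLex x k).natAbs - 1)

lemma nodeSet_congr {α : Type*} (r : α) (P : α → ℕ → α) (x y : DD) (k : ℕ)
    (h : ∀ j < k, ofLex x j = ofLex y j) : nodeSet r P x k = nodeSet r P y k := by
  induction k with
  | zero => rfl
  | succ k ih =>
    simp only [nodeSet]
    rw [ih fun j hj => h j (by omega), h k (by omega)]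

lemma katetov_nwd (I : Set (Set ℕ)) (hI : IsIdeal I)
    (hfam : ∀ X, X ∉ I → ∃ P : ℕ → Set ℕ, (∀ i, P i ⊆ X) ∧ (∀ i, P i ∉ I) ∧
      ∀ E ∈ I, ∃ i, P i ∩ E = ∅) : KatetovLE I nwdQ := by
  have hfam' : ∀ X : {X : Set ℕ // X ∉ I}, ∃ P : ℕ → {X : Set ℕ // X ∉ I},
      (∀ i, (P i).1 ⊆ X.1) ∧ ∀ E ∈ I, ∃ i, (P i).1 ∩ E = ∅ := by
    rintro ⟨X, hX⟩
    obtain ⟨P, h1, h2, h3⟩ := hfam X hX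
    exact ⟨fun i => ⟨P i, h2 i⟩, h1, h3⟩
  choose P hP1 hP2 using hfam'
  let N : DD → ℕ → {X : Set ℕ // X ∉ I} := nodeSet ⟨Set.univ, hI.2.1⟩ P
  have hNanti : ∀ x, Antitone fun k => (N x k).1 := fun x =>
    antitone_nat_of_succ_le fun k => hP1 _ _
  have hNne : ∀ x k, (N x k).1.Nonempty := by
    intro x k
    rw [Set.nonempty_iff_ne_empty]
    intro h
    exact (N x k).2 (h ▸ hI.1)
  let K : DD → ℕ := fun x => (ofLex x).support.sup (· + 1)
  have hK : ∀ (x : DD) (m : ℕ), ofLex x m ≠ 0 → m + 1 ≤ K x := by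
    intro x m h
    exact Finset.le_sup (f := (· + 1)) (Finsupp.mem_support_iff.2 h)
  choose f hf using fun x => hNne x (K x)
  obtain ⟨φ⟩ := Order.iso_of_countable_dense ℚ DD
  refine ⟨fun q => f (φ q), fun E hE => ?_⟩
  change interior (closure _) = ∅
  rw [Set.eq_empty_iff_forall_notMem]
  intro q hq
  rw [mem_interior_iff_mem_nhds, mem_nhds_iff_exists_Ioo_subset] at hq
  obtain ⟨a, b, hqab, hsub⟩ := hq
  obtain ⟨u, m, hu⟩ := cone_in (φ a) (φ b) (φ.lt_iff_lt.2 (hqab.1.trans hqab.2))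
  obtain ⟨i, hi⟩ := hP2 (N u m) E hE
  let t : DD := bump u m ((i : ℤ) + 1 - ofLex u m)
  have htm : ofLex t m = (i : ℤ) + 1 := by rw [bump_eq]; ring
  have htu : ∀ j < m, ofLex t j = ofLex u j := fun j hj => bump_ne _ _ _ _ hj.ne
  have htd := lt_bump t (m + 1)
  have hcone : ∀ x, t < x → x < bump t (m + 1) 1 → f x ∉ E ∧ φ a < x ∧ x < φ b := by
    intro x h1 h2
    have hx := cone_out t (m + 1) x h1 h2
    have hxu : ∀ j < m, ofLex x j = ofLex u j := fun j hj => by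
      rw [hx j (by omega), htu j hj]
    refine ⟨fun hxE => ?_, hu x hxu⟩
    have hxm : ofLex x m = (i : ℤ) + 1 := by rw [hx m (by omega), htm]
    have h3 : m + 1 ≤ K x := hK x m (by rw [hxm]; omega)
    have h4 : f x ∈ (N x (m + 1)).1 := hNanti x h3 (hf x)
    have h5 : N x (m + 1) = P (N u m) i := by
      have h6 : N x m = N u m := nodeSet_congr _ _ _ _ _ hxu
      have h7 : N x (m + 1) = P (N x m) ((ofLex x m).natAbs - 1) := rfl
      rw [h7, h6, hxm]
      congr 1
    rw [h5] at h4
    have : f x ∈ (P (N u m) i).1 ∩ E := ⟨h4, hxE⟩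
    rw [hi] at this
    exact this
  obtain ⟨c, hc⟩ : ∃ c, φ c = t := φ.surjective t
  obtain ⟨d, hd⟩ := φ.surjective (bump t (m + 1) 1)
  rw [← hd, ← hc] at hcone htd
  obtain ⟨r, hr1, hr2⟩ := exists_between (φ.lt_iff_lt.1 htd)
  have h1 := hcone (φ r) (φ.lt_iff_lt.2 hr1) (φ.lt_iff_lt.2 hr2)
  have hrc := hsub ⟨φ.lt_iff_lt.1 h1.2.1, φ.lt_iff_lt.1 h1.2.2⟩
  obtain ⟨z, hz, hzE⟩ := mem_closure_iff.1 hrc (Set.Ioo c d) isOpen_Ioo ⟨hr1, hr2⟩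
  exact (hcone (φ z) (φ.lt_iff_lt.2 hz.1) (φ.lt_iff_lt.2 hz.2)).1 hzE

/-- Hrušák's Category Dichotomy: every Borel ideal `I` on `ℕ` satisfies either
`I ≤_K nwd(ℚ)` or `ED ≤_K I↾X` for some `I`-positive `X`. -/
theorem category_dichotomy (I : Set (Set ℕ)) (hI : IsIdeal I) (hfin : ContainsFin I)
    (hBorel : MeasurableSet (chi '' I)) :
    KatetovLE I nwdQ ∨ ∃ X : Set ℕ, X ∉ I ∧ KatetovLE ED (restrictIdeal I X) := by
  by_cases hED : ∃ X : Set ℕ, X ∉ I ∧ KatetovLE ED (restrictIdeal I X)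
  · exact Or.inr hED
  left
  have hsel := locSel_of_not I hI hED
  have hne : (chi '' I).Nonempty := ⟨_, ∅, hI.1, rfl⟩
  haveI : PolishSpace Bool :=
    ((continuous_of_discreteTopology (f := Bool.toNat)).isClosedEmbedding
      (fun a b h => by revert h; cases a <;> cases b <;> simp)).polishSpace
  have han : MeasureTheory.AnalyticSet (chi '' I) := hBorel.analyticSet
  rw [MeasureTheory.AnalyticSet] at han
  obtain ⟨f, hfc, hf⟩ := han.resolve_left hne.ne_empty
  refine katetov_nwd I hI fun X hX => ?_
  by_cases hw : WinII I f X [] []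
  · exact win_family I hI f hf X hw
  · exfalso
    obtain ⟨A, hA, hrun⟩ := not_win_strategy I hI f hfc hf X hw
    obtain ⟨n, h1, h2, h3⟩ := positive_run I hI hfin hsel X hX A hA
    exact h3 (hrun n h1 h2)
end

section
/- (Sakai) The family of all analytic P-ideals on ℕ has a largest element with respect to the Katětov–Blass order: there is an analytic P-ideal J on ℕ such that I ≤_KB J for every analytic P-ideal I on ℕ. -/
open Set Filter Topology

/-- Katětov–Blass order: reduction by a finite-to-one function. -/
def KatetovBlassLE (I J : Set (Set ℕ)) : Prop :=
  ∃ f : ℕ → ℕ, (∀ n, (f ⁻¹' {n}).Finite) ∧ ∀ E ∈ I, f ⁻¹' E ∈ J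

/-- A family of finite sets is big for `I` if it contains all finite subsets of a tail of each
member of `I`. -/
def BigFam (I : Set (Set ℕ)) (K : Set (Finset ℕ)) : Prop :=
  ∀ A ∈ I, ∃ m, ∀ F : Finset ℕ, ↑F ⊆ A → (∀ a ∈ F, m ≤ a) → F ∈ K

/-- basic cylinder -/
def cyl (x : ℕ → ℕ) (l : ℕ) : Set (ℕ → ℕ) := {y | ∀ i < l, y i = x i}

def CofFam (I : Set (Set ℕ)) (g : (ℕ → ℕ) → Set ℕ) (U : Set (ℕ → ℕ)) : Prop :=
  ∀ A ∈ I, ∃ z ∈ U, (A \ g z).Finite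

lemma cof_sigma {I : Set (Set ℕ)} (hP : IsPIdeal I) {g : (ℕ → ℕ) → Set ℕ} {ι : Type}
    [Countable ι] [Nonempty ι]
    (U : ι → Set (ℕ → ℕ)) (W : Set (ℕ → ℕ)) (hW : CofFam I g W) (h : W ⊆ ⋃ i, U i) :
    ∃ i, CofFam I g (U i) := by
  by_contra hc
  simp only [CofFam] at hc
  push Not at hc
  choose A hA hA' using hc
  obtain ⟨φ, hφ⟩ := exists_surjective_nat ι
  obtain ⟨F, hF, hF'⟩ := hP (fun n => A (φ n)) (fun n => hA _)
  obtain ⟨z, hz, hz'⟩ := hW F hF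
  obtain ⟨i, hi⟩ := mem_iUnion.1 (h hz)
  obtain ⟨n, rfl⟩ := hφ i
  refine hA' _ z hi (((hF' n).union hz').subset ?_)
  intro a ha
  by_cases haF : a ∈ F
  · exact Or.inr ⟨haF, ha.2⟩
  · exact Or.inl ⟨ha.1, haF⟩

lemma cof_inter {I : Set (Set ℕ)} (hP : IsPIdeal I) {g : (ℕ → ℕ) → Set ℕ}
    (W : Set (ℕ → ℕ)) (hW : CofFam I g W) :
    CofFam I g (W ∩ {x | ∀ l, CofFam I g (cyl x l)}) := by
  classical
  let c : (Σ l : ℕ, (Fin l → ℕ)) → Set (ℕ → ℕ) := fun s => {y | ∀ i : Fin s.1, y i = s.2 i}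
  have hc : ∀ y l, c ⟨l, fun i => y i⟩ = cyl y l := by
    intro y l
    ext z
    simp only [c, cyl, mem_ofPred_eq]
    exact ⟨fun h i hi => h ⟨i, hi⟩, fun h i => h i i.2⟩
  by_contra hcon
  have : Nonempty (Σ l : ℕ, (Fin l → ℕ)) := ⟨⟨0, fun _ => 0⟩⟩
  obtain ⟨i, hi⟩ := cof_sigma (I := I) hP (g := g)
    (fun s => if CofFam I g (c s) then W ∩ {x | ∀ l, CofFam I g (cyl x l)} else c s) W hW (by
      intro y hy
      rw [mem_iUnion]
      by_cases hyP : ∀ l, CofFam I g (cyl y l)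
      · refine ⟨⟨0, fun i => y i⟩, ?_⟩
        rw [hc, if_pos (hyP 0)]
        exact ⟨hy, hyP⟩
      · push Not at hyP
        obtain ⟨l, hl⟩ := hyP
        refine ⟨⟨l, fun i => y i⟩, ?_⟩
        rw [hc, if_neg hl]
        exact fun i _ => rfl)
  split_ifs at hi with h
  · exact hcon hi
  · exact h hi

/-- Abstract tree extracted from an analytic P-ideal. -/
lemma exists_tree {I : Set (Set ℕ)} (hI : IsIdeal I)
    (hA : MeasureTheory.AnalyticSet (chi '' I)) (hP : IsPIdeal I) :
    ∃ (T : Type) (le : T → T → Prop) (fo : T → Finset ℕ → Prop), Nonempty T ∧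
      (∀ t, BigFam I {F | ∃ t', le t' t ∧ fo t' F}) ∧
      ∀ (t : ℕ → T) (F : ℕ → Finset ℕ), (∀ n, le (t (n+1)) (t n)) → (∀ n, fo (t (n+1)) (F n)) →
        ∃ B ∈ I, ∀ n, ↑(F n) ⊆ B := by
  rw [MeasureTheory.AnalyticSet] at hA
  rcases hA with hA | ⟨f, hf, hr⟩
  · exact absurd (mem_image_of_mem chi hI.1) (by rw [hA]; exact notMem_empty _)
  let g : (ℕ → ℕ) → Set ℕ := fun z => {n | f z n = true}
  have hchi : ∀ A : Set ℕ, {n | chi A n = true} = A := by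
    intro A; ext n; simp [chi]
  have hgI : ∀ z, g z ∈ I := by
    intro z
    obtain ⟨A, hAI, hA⟩ : f z ∈ chi '' I := hr ▸ mem_range_self z
    have : g z = A := by simp only [g, ← hA, hchi]
    rwa [this]
  have hgs : ∀ A ∈ I, ∃ z, g z = A := by
    intro A hA
    obtain ⟨z, hz⟩ : chi A ∈ range f := hr ▸ mem_image_of_mem chi hA
    exact ⟨z, by simp only [g, hz, hchi]⟩
  have hcont : ∀ z (F : Finset ℕ), ↑F ⊆ g z → ∃ l, ∀ y ∈ cyl z l, ↑F ⊆ g y := by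
    intro z F hF
    have hopen : IsOpen {y | ↑F ⊆ g y} := by
      have : {y | ↑F ⊆ g y} = ⋂ n ∈ F, {y | f y n = true} := by
        ext y; simp only [g, mem_ofPred_eq, mem_iInter]; rfl
      rw [this]
      refine isOpen_biInter_finset fun n _ => ?_
      have h2 : Continuous fun y => f y n := (continuous_apply n).comp hf
      exact (isOpen_discrete ({true} : Set Bool)).preimage h2
    obtain ⟨_, ⟨x, l, rfl⟩, hz, hsub⟩ :=
      (PiNat.isTopologicalBasis_cylinders (fun _ : ℕ => ℕ)).exists_subset_of_mem_open
        (show z ∈ {y | ↑F ⊆ g y} from hF) hopen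
    refine ⟨l, fun y hy => hsub ?_⟩
    rw [PiNat.mem_cylinder_iff] at hz ⊢
    exact fun i hi => (hy i hi).trans (hz i hi)
  let P : Set (ℕ → ℕ) := {x | ∀ l, CofFam I g (cyl x l)}
  have huniv : CofFam I g univ := by
    intro A hA
    obtain ⟨z, hz⟩ := hgs A hA
    exact ⟨z, mem_univ _, by simp [hz]⟩
  refine ⟨P × ℕ, fun t' t => t'.1.1 ∈ cyl t.1.1 t.2 ∧ t.2 < t'.2,
    fun t F => ∀ z ∈ cyl t.1.1 t.2, ↑F ⊆ g z, ?_, ?_, ?_⟩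
  · obtain ⟨z, hz, -⟩ := cof_inter hP univ huniv ∅ hI.1
    exact ⟨⟨⟨z, hz.2⟩, 0⟩⟩
  · rintro ⟨⟨x, hx⟩, l⟩ A hA
    obtain ⟨z, hz, hfin⟩ := cof_inter hP _ (hx l) A hA
    obtain ⟨m, hm⟩ := hfin.bddAbove
    refine ⟨m + 1, fun F hF hFm => ?_⟩
    obtain ⟨l', hl'⟩ := hcont z F (fun a ha => by
      by_contra hc
      have h1 := hm ⟨hF ha, hc⟩
      have h2 := hFm a ha
      omega)
    refine ⟨⟨⟨z, hz.2⟩, max l' (l+1)⟩, ⟨hz.1, by simp⟩, fun y hy => hl' y ?_⟩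
    exact fun i hi => hy i (lt_of_lt_of_le hi (le_max_left _ _))
  · intro t F hle hfo
    have hln : ∀ n, n ≤ (t n).2 := by
      intro n
      induction n with
      | zero => simp
      | succ n ih => have := (hle n).2; omega
    have hmono : ∀ n k, (t n).2 ≤ (t (n+k)).2 ∧ (t (n+k)).1.1 ∈ cyl (t n).1.1 (t n).2 := by
      intro n k
      induction k with
      | zero => exact ⟨le_rfl, fun i _ => rfl⟩
      | succ k ih =>
        have := hle (n+k)
        refine ⟨ih.1.trans this.2.le, fun i hi => ?_⟩
        exact (this.1 i (lt_of_lt_of_le hi ih.1)).trans (ih.2 i hi)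
    let z : ℕ → ℕ := fun i => (t (i+1)).1.1 i
    have hz : ∀ n, z ∈ cyl (t n).1.1 (t n).2 := by
      intro n i hi
      rcases le_total n (i+1) with h | h
      · obtain ⟨k, hk⟩ := Nat.exists_eq_add_of_le h
        have := (hmono n k).2 i hi
        rw [← hk] at this
        exact this
      · obtain ⟨k, hk⟩ := Nat.exists_eq_add_of_le h
        have := (hmono (i+1) k).2 i (lt_of_lt_of_le (Nat.lt_succ_self i) (hln (i+1)))
        rw [← hk] at this
        exact this.symm
    exact ⟨g z, hgI z, fun n => hfo n z (hz (n+1))⟩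

lemma BigFam.inter {I : Set (Set ℕ)} {K L : Set (Finset ℕ)} (hK : BigFam I K) (hL : BigFam I L) :
    BigFam I (K ∩ L) := by
  intro A hA
  obtain ⟨m, hm⟩ := hK A hA
  obtain ⟨n, hn⟩ := hL A hA
  exact ⟨max m n, fun F hF h => ⟨hm F hF fun a ha => (le_max_left _ _).trans (h a ha),
    hn F hF fun a ha => (le_max_right _ _).trans (h a ha)⟩⟩

lemma bigFam_tail (I : Set (Set ℕ)) (m : ℕ) : BigFam I {F | ∀ a ∈ F, m ≤ a} :=
  fun _ _ => ⟨m, fun _ _ h => h⟩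

lemma BigFam.core {I : Set (Set ℕ)} {K : Set (Finset ℕ)} (hK : BigFam I K) :
    BigFam I {F | ∀ G ⊆ F, G ∈ K} := by
  intro A hA
  obtain ⟨m, hm⟩ := hK A hA
  exact ⟨m, fun F hF h G hG => hm G (fun a ha => hF (hG ha)) fun a ha => h a (hG ha)⟩

lemma big_double {I : Set (Set ℕ)} (hI : IsIdeal I)
    (hA : MeasureTheory.AnalyticSet (chi '' I)) (hP : IsPIdeal I) {K : Set (Finset ℕ)}
    (hK : BigFam I K) :
    ∃ K', BigFam I K' ∧ (∀ F ∈ K', ∀ G ⊆ F, G ∈ K') ∧ ∀ F ∈ K', ∀ G ∈ K', F ∪ G ∈ K := by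
  suffices h : ∃ K', BigFam I K' ∧ ∀ F ∈ K', ∀ G ∈ K', F ∪ G ∈ K by
    obtain ⟨K', h1, h2⟩ := h
    exact ⟨_, h1.core, fun F hF G hG H hH => hF H (hH.trans hG),
      fun F hF G hG => h2 F (hF F subset_rfl) G (hG G subset_rfl)⟩
  by_contra hcon
  push Not at hcon
  obtain ⟨T, le, fo, ⟨t0⟩, h1, h2⟩ := exists_tree hI hA hP
  have step : ∀ (p : T × T) (m : ℕ), ∃ (q : T × T) (F G : Finset ℕ), le q.1 p.1 ∧ le q.2 p.2 ∧
      fo q.1 F ∧ fo q.2 G ∧ (∀ a ∈ F ∪ G, m ≤ a) ∧ F ∪ G ∉ K := by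
    intro p m
    obtain ⟨F, hF, G, hG, hn⟩ := hcon _ (((h1 p.1).inter (h1 p.2)).inter (bigFam_tail I m))
    obtain ⟨⟨⟨t, ht, ht'⟩, -⟩, hFm⟩ := hF
    obtain ⟨⟨-, ⟨s, hs, hs'⟩⟩, hGm⟩ := hG
    refine ⟨(t, s), F, G, ht, hs, ht', hs', ?_, hn⟩
    intro a ha
    rcases Finset.mem_union.1 ha with h | h
    · exact hFm a h
    · exact hGm a h
  choose q F G hq1 hq2 hF hG hm hn using step
  let p : ℕ → T × T := fun n => Nat.rec (t0, t0) (fun n r => q r n) n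
  obtain ⟨B, hB, hB'⟩ := h2 (fun n => (p n).1) (fun n => F (p n) n) (fun n => hq1 (p n) n)
    (fun n => hF (p n) n)
  obtain ⟨C, hC, hC'⟩ := h2 (fun n => (p n).2) (fun n => G (p n) n) (fun n => hq2 (p n) n)
    (fun n => hG (p n) n)
  obtain ⟨m, hm'⟩ := hK (B ∪ C) (hI.2.2.1 B C hB hC)
  refine hn (p m) m (hm' _ ?_ (hm (p m) m))
  rw [Finset.coe_union]
  exact union_subset_union (hB' m) (hC' m)

lemma big_start {I : Set (Set ℕ)} (hI : IsIdeal I) (hfin : ContainsFin I)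
    (hA : MeasureTheory.AnalyticSet (chi '' I)) (hP : IsPIdeal I) :
    ∃ K, BigFam I K ∧ ∀ m, ∃ F : Finset ℕ, (∀ a ∈ F, m ≤ a) ∧ F ∉ K := by
  by_contra hcon
  push Not at hcon
  obtain ⟨T, le, fo, ⟨t0⟩, h1, h2⟩ := exists_tree hI hA hP
  choose M hM using fun t => hcon _ (h1 t)
  -- state: (t, m) current node, (s, n) next node, with m ≤ n
  have step : ∀ (p q : T × ℕ), ∃ r : T × ℕ, M p.1 ≤ p.2 →
      (le r.1 p.1 ∧ fo r.1 (Finset.Ico p.2 q.2) ∧ M r.1 ≤ r.2 ∧ q.2 < r.2) := by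
    intro p q
    by_cases h : M p.1 ≤ p.2
    · obtain ⟨t, ht, ht'⟩ := hM p.1 (Finset.Ico p.2 q.2)
        (fun a ha => h.trans (Finset.mem_Ico.1 ha).1)
      exact ⟨(t, max (M t) (q.2 + 1)), fun _ => ⟨ht, ht', le_max_left _ _,
        Nat.lt_of_succ_le (le_max_right _ _)⟩⟩
    · exact ⟨p, fun h' => absurd h' h⟩
  choose r hr using step
  let w : ℕ → (T × ℕ) × (T × ℕ) := fun n =>
    Nat.rec ((t0, M t0), (t0, M t0)) (fun _ u => (u.2, r u.1 u.2)) n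
  have hw : ∀ n, M (w n).1.1 ≤ (w n).1.2 ∧ M (w n).2.1 ≤ (w n).2.2 := by
    intro n
    induction n with
    | zero => exact ⟨le_rfl, le_rfl⟩
    | succ n ih => exact ⟨ih.2, (hr (w n).1 (w n).2 ih.1).2.2.1⟩
  let v : ℕ → T × ℕ := fun n => (w n).1
  have hv : ∀ n, le (v (n+2)).1 (v n).1 ∧ fo (v (n+2)).1 (Finset.Ico (v n).2 (v (n+1)).2) := by
    intro n
    have := hr (w n).1 (w n).2 (hw n).1
    exact ⟨this.1, this.2.1⟩
  have hmon : ∀ n, (v (n+1)).2 < (v (n+2)).2 := fun n => (hr (w n).1 (w n).2 (hw n).1).2.2.2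
  obtain ⟨B, hB, hB'⟩ := h2 (fun n => (v (2*n)).1)
    (fun n => Finset.Ico (v (2*n)).2 (v (2*n+1)).2) (fun n => (hv (2*n)).1) (fun n => (hv (2*n)).2)
  obtain ⟨C, hC, hC'⟩ := h2 (fun n => (v (2*n+1)).1)
    (fun n => Finset.Ico (v (2*n+1)).2 (v (2*n+2)).2) (fun n => (hv (2*n+1)).1)
    (fun n => (hv (2*n+1)).2)
  have hbig : ∀ n, n ≤ (v (n+1)).2 := by
    intro n
    induction n with
    | zero => exact Nat.zero_le _
    | succ n ih => exact Nat.succ_le_of_lt (lt_of_le_of_lt ih (hmon n))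
  have hcov : ∀ n, (Finset.Ico (v n).2 (v (n+1)).2 : Set ℕ) ⊆ B ∪ C := by
    intro n
    rcases Nat.even_or_odd' n with ⟨k, rfl | rfl⟩
    · exact (hB' k).trans subset_union_left
    · exact (hC' k).trans subset_union_right
  have hall : ∀ n a, (v 0).2 ≤ a → a < (v n).2 → a ∈ B ∪ C := by
    intro n a ha
    induction n with
    | zero => intro h; omega
    | succ n ih =>
      intro h
      by_cases h' : a < (v n).2
      · exact ih h'
      · exact hcov n (by simp only [Finset.coe_Ico, mem_Ico]; omega)
  apply hI.2.1
  refine hI.2.2.2 _ _ ?_ (hI.2.2.1 _ _ (hI.2.2.1 B C hB hC) (hfin _ (finite_Iio (v 0).2)))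
  intro a _
  by_cases ha : a < (v 0).2
  · exact Or.inr ha
  · exact Or.inl (hall (a+2) a (not_lt.1 ha) (hbig (a+1)))

/-- The combinatorial consequence of Solecki's theorem which is needed. -/
lemma exists_families {I : Set (Set ℕ)} (hI : IsIdeal I) (hfin : ContainsFin I)
    (hA : MeasureTheory.AnalyticSet (chi '' I)) (hP : IsPIdeal I) :
    ∃ C : ℕ → Set (Finset ℕ), (∀ n, BigFam I (C n)) ∧ (∀ n, ∀ F ∈ C n, ∀ G ⊆ F, G ∈ C n) ∧
      (∀ n, ∀ F ∈ C (n+1), ∀ G ∈ C (n+1), F ∪ G ∈ C n) ∧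
      ∀ m, ∃ F : Finset ℕ, (∀ a ∈ F, m ≤ a) ∧ ∀ n, F ∉ C n := by
  obtain ⟨K, hK, hKm⟩ := big_start hI hfin hA hP
  let S := {K : Set (Finset ℕ) // BigFam I K ∧ ∀ F ∈ K, ∀ G ⊆ F, G ∈ K}
  have step : ∀ K : S, ∃ K' : S, ∀ F ∈ K'.1, ∀ G ∈ K'.1, F ∪ G ∈ K.1 := by
    rintro ⟨K, hK, -⟩
    obtain ⟨K', h1, h2, h3⟩ := big_double hI hA hP hK
    exact ⟨⟨K', h1, h2⟩, h3⟩
  choose d hd using step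
  let s : ℕ → S := fun n => Nat.rec ⟨_, hK.core, fun F hF G hG H hH => hF H (hH.trans hG)⟩
    (fun _ r => d r) n
  refine ⟨fun n => (s n).1, fun n => (s n).2.1, fun n => (s n).2.2, fun n => hd (s n), fun m => ?_⟩
  obtain ⟨F, hF, hFK⟩ := hKm m
  refine ⟨F, hF, fun n => ?_⟩
  induction n with
  | zero => exact fun h => hFK (h F subset_rfl)
  | succ n ih =>
    intro h
    have := hd (s n) F h F h
    rw [Finset.union_self] at this
    exact ih this

/-- Finite structures on `j` points. -/
def ValidS (j : ℕ) (c : Fin j → Set (Set (Fin j))) : Prop :=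
  (∀ i, ∅ ∈ c i) ∧ (∀ i, univ ∉ c i) ∧ (∀ i, ∀ E ∈ c i, ∀ E' ⊆ E, E' ∈ c i) ∧
    ∀ i i' : Fin j, i.1 + 1 = i'.1 → ∀ E ∈ c i', ∀ E' ∈ c i', E ∪ E' ∈ c i

/-- All finite structures on `j` points. -/
abbrev StrS (j : ℕ) : Type := {c : Fin j → Set (Set (Fin j)) // ValidS j c}

/-- The `j`-th block. -/
abbrev BlkS (j : ℕ) : Type := StrS j → Fin j

/-- The small sets in the `j`-th block. -/
def SmallS (n j : ℕ) : Set (Set (BlkS j)) :=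
  {A | ∃ h : n < j, ∃ E : StrS j → Set (Fin j), (∀ c, E c ∈ c.1 ⟨n, h⟩) ∧
    A ⊆ {x | ∃ c, x c ∈ E c}}

def JS (e : (Σ j, BlkS j) ≃ ℕ) : Set (Set ℕ) :=
  {A | ∀ n, ∀ᶠ j in atTop, {x : BlkS j | e ⟨j, x⟩ ∈ A} ∈ SmallS n j}

lemma smallS_mono {n j : ℕ} {A B : Set (BlkS j)} (h : A ⊆ B) (hB : B ∈ SmallS n j) :
    A ∈ SmallS n j := by
  obtain ⟨h1, E, hE, hB⟩ := hB
  exact ⟨h1, E, hE, h.trans hB⟩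

lemma smallS_union {n j : ℕ} {A B : Set (BlkS j)} (hA : A ∈ SmallS (n+1) j)
    (hB : B ∈ SmallS (n+1) j) : A ∪ B ∈ SmallS n j := by
  obtain ⟨h1, E, hE, hA⟩ := hA
  obtain ⟨_, E', hE', hB⟩ := hB
  refine ⟨by omega, fun c => E c ∪ E' c, fun c => c.2.2.2.2 _ ⟨n+1, h1⟩ rfl _ (hE c) _ (hE' c), ?_⟩
  rintro x (hx | hx)
  · obtain ⟨c, hc⟩ := hA hx
    exact ⟨c, Or.inl hc⟩
  · obtain ⟨c, hc⟩ := hB hx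
    exact ⟨c, Or.inr hc⟩

lemma smallS_empty {n j : ℕ} (h : n < j) : (∅ : Set (BlkS j)) ∈ SmallS n j :=
  ⟨h, fun _ => ∅, fun c => c.2.1 _, empty_subset _⟩

lemma smallS_univ {n j : ℕ} : (univ : Set (BlkS j)) ∉ SmallS n j := by
  rintro ⟨h, E, hE, hu⟩
  have : ∀ c, ∃ y, y ∉ E c := by
    intro c
    by_contra hc
    push Not at hc
    exact c.2.2.1 _ (eq_univ_of_forall hc ▸ hE c)
  choose x hx using this
  obtain ⟨c, hc⟩ := hu (mem_univ x)
  exact hx c hc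

lemma JS_ideal (e : (Σ j, BlkS j) ≃ ℕ) : IsIdeal (JS e) := by
  refine ⟨?_, ?_, ?_, ?_⟩
  · intro n
    filter_upwards [eventually_gt_atTop n] with j hj
    simpa using smallS_empty hj
  · intro h
    obtain ⟨j, hj⟩ := (h 0).exists
    exact smallS_univ (by simpa using hj)
  · intro A B hA hB n
    filter_upwards [hA (n+1), hB (n+1)] with j h1 h2
    exact smallS_union h1 h2
  · intro A B hAB hB n
    filter_upwards [hB n] with j h
    exact smallS_mono (fun x hx => hAB hx) h

lemma JS_fin (e : (Σ j, BlkS j) ≃ ℕ) : ContainsFin (JS e) := by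
  intro A hA n
  have hfin : ((fun a => (e.symm a).1) '' A).Finite := hA.image _
  obtain ⟨m, hm⟩ := hfin.bddAbove
  filter_upwards [eventually_gt_atTop n, eventually_gt_atTop m] with j hj hjm
  convert smallS_empty hj
  ext x
  simp only [mem_ofPred_eq, mem_empty_iff_false, iff_false]
  intro hx
  have := hm (mem_image_of_mem _ hx)
  simp only [Equiv.symm_apply_apply] at this
  omega

lemma JS_analytic (e : (Σ j, BlkS j) ≃ ℕ) : MeasureTheory.AnalyticSet (chi '' (JS e)) := by
  have hm : MeasurableSet {b : ℕ → Bool | {n | b n = true} ∈ JS e} := by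
    have : {b : ℕ → Bool | {n | b n = true} ∈ JS e} = ⋂ n, ⋃ N, ⋂ j, ⋂ (_ : N ≤ j),
        {b : ℕ → Bool | {x : BlkS j | b (e ⟨j, x⟩) = true} ∈ SmallS n j} := by
      ext b
      simp [JS, eventually_atTop]
    rw [this]
    refine MeasurableSet.iInter fun n => MeasurableSet.iUnion fun N => MeasurableSet.iInter fun j =>
      MeasurableSet.iInter fun _ => ?_
    have hme : Measurable (fun (b : ℕ → Bool) (x : BlkS j) => b (e ⟨j, x⟩)) :=
      measurable_pi_lambda _ fun x => measurable_pi_apply _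
    exact hme (t := {b' : BlkS j → Bool | {x | b' x = true} ∈ SmallS n j})
      (Set.toFinite _).measurableSet
  have heq : chi '' (JS e) = {b : ℕ → Bool | {n | b n = true} ∈ JS e} := by
    ext b
    constructor
    · rintro ⟨A, hA, rfl⟩
      have : {n | chi A n = true} = A := by ext n; simp [chi]
      simpa [this] using hA
    · intro hb
      refine ⟨_, hb, ?_⟩
      funext n
      simp [chi]
  rw [heq]
  simpa using hm.analyticSet_image measurable_id

lemma JS_P (e : (Σ j, BlkS j) ≃ ℕ) : IsPIdeal (JS e) := by
  intro E hE
  have hU : ∀ i, (⋃ l ∈ Iic i, E l) ∈ JS e := by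
    intro i
    induction i with
    | zero => simpa using hE 0
    | succ i ih =>
      refine (JS_ideal e).2.2.2 _ _ ?_ ((JS_ideal e).2.2.1 _ _ ih (hE (i+1)))
      intro a ha
      simp only [mem_iUnion, mem_Iic, mem_union] at ha ⊢
      obtain ⟨l, hl, ha⟩ := ha
      rcases Nat.lt_or_ge i l with h | h
      · have : l = i + 1 := by omega
        exact Or.inr (this ▸ ha)
      · exact Or.inl ⟨l, h, ha⟩
  have hN : ∀ i, ∃ N, ∀ j ≥ N, ∀ n ≤ i, {x : BlkS j | e ⟨j, x⟩ ∈ ⋃ l ∈ Iic i, E l} ∈ SmallS n j := by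
    intro i
    rw [← eventually_atTop]
    have := (eventually_all_finite (finite_Iic i)).2 (fun n _ => hU i n)
    exact this
  choose N hN using hN
  -- F: points of `E l` in blocks `j` whose active level is at least `l`
  refine ⟨{a | ∃ l, a ∈ E l ∧ ∀ i ≤ l, N i + i ≤ (e.symm a).1}, ?_, ?_⟩
  · intro n
    filter_upwards [eventually_ge_atTop ((Finset.range (n+1)).sup (fun i => N i + i)),
      eventually_gt_atTop n] with j hj hnj
    have hj' : ∀ i ≤ n, N i + i ≤ j := fun i hi =>
      (Finset.le_sup (f := fun i => N i + i) (Finset.mem_range.2 (by omega))).trans hj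
    let Q : ℕ → Prop := fun l => ∀ i ≤ l, N i + i ≤ j
    classical
    let k := Nat.findGreatest Q j
    have hkQ : Q k := Nat.findGreatest_spec (P := Q) (m := n) hnj.le hj'
    have hnk : n ≤ k := Nat.le_findGreatest hnj.le hj'
    refine smallS_mono ?_ (hN k j (by have := hkQ k le_rfl; omega) n hnk)
    rintro x ⟨l, hl, hl'⟩
    simp only [Equiv.symm_apply_apply] at hl'
    have hlk : l ≤ k := Nat.le_findGreatest (by have := hl' l le_rfl; omega) hl'
    simp only [mem_ofPred_eq, mem_iUnion, mem_Iic]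
    exact ⟨l, hlk, hl⟩
  · intro l
    let M := (Finset.range (l+1)).sup (fun i => N i + i)
    have hM : ∀ i ≤ l, N i + i ≤ M := fun i hi =>
      Finset.le_sup (f := fun i => N i + i) (Finset.mem_range.2 (by omega))
    have hfin : (⋃ j ∈ Iio M, range (fun x : BlkS j => e ⟨j, x⟩)).Finite :=
      (finite_Iio M).biUnion fun j _ => finite_range _
    refine hfin.subset ?_
    rintro a ⟨ha, hna⟩
    simp only [mem_iUnion, mem_range, mem_Iio]
    refine ⟨(e.symm a).1, ?_, (e.symm a).2, by simp⟩
    by_contra hc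
    exact hna ⟨l, ha, fun i hi => (hM i hi).trans (not_lt.1 hc)⟩

lemma JS_max (e : (Σ j, BlkS j) ≃ ℕ) {I : Set (Set ℕ)} (hI : IsIdeal I) (hfin : ContainsFin I)
    (hA : MeasureTheory.AnalyticSet (chi '' I)) (hP : IsPIdeal I) : KatetovBlassLE I (JS e) := by
  classical
  obtain ⟨C, hbig, hher, hdbl, hout⟩ := exists_families hI hfin hA hP
  choose F hFm hF using hout
  have hempty : ∀ n, ∅ ∈ C n := by
    intro n
    obtain ⟨m, hm⟩ := hbig n ∅ hI.1
    exact hm ∅ (by simp) (by simp)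
  have hne : ∀ k, ∃ a, a ∈ F k := by
    intro k
    by_contra hc
    push Not at hc
    exact hF k 0 (Finset.eq_empty_of_forall_notMem hc ▸ hempty 0)
  choose p hp using hne
  let r : ℕ → ℕ → ℕ := fun k a => if a ∈ F k then a else p k
  have hr : ∀ k a, r k a ∈ F k := by
    intro k a
    simp only [r]
    split_ifs with h
    · exact h
    · exact hp k
  let Q : ℕ → ℕ → Prop := fun j k => ∀ a ∈ F k, a < j
  let k : ℕ → ℕ := fun j => Nat.findGreatest (Q j) j
  have hk : ∀ m, ∀ᶠ j in atTop, m ≤ k j ∧ Q j (k j) := by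
    intro m
    filter_upwards [eventually_ge_atTop m, eventually_gt_atTop ((F m).sup id)] with j h1 h2
    have : Q j m := fun a ha => lt_of_le_of_lt (Finset.le_sup (f := id) ha) h2
    exact ⟨Nat.le_findGreatest h1 this, Nat.findGreatest_spec (P := Q j) h1 this⟩
  -- trace of a subset of `Fin j` on `F (k j)`
  let tr : ∀ j, Set (Fin j) → Finset ℕ := fun j E => (F (k j)).filter (fun a => ∃ h : a < j, ⟨a, h⟩ ∈ E)
  let cs : ∀ j, Fin j → Set (Set (Fin j)) := fun j n => {E | tr j E ∈ C n}
  have hvalid : ∀ j, Q j (k j) → ValidS j (cs j) := by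
    intro j hQ
    refine ⟨?_, ?_, ?_, ?_⟩
    · intro n
      have : tr j ∅ = ∅ := by simp [tr]
      simp only [cs, mem_ofPred_eq, this, hempty]
    · intro n
      have : tr j univ = F (k j) := by
        simp only [tr, mem_univ, exists_prop, and_true]
        exact Finset.filter_true_of_mem hQ
      simp only [cs, mem_ofPred_eq, this]
      exact hF _ _
    · intro n E hE E' hE'
      refine hher _ _ hE _ ?_
      intro a ha
      simp only [tr, Finset.mem_filter] at ha ⊢
      obtain ⟨h1, h2, h3⟩ := ha
      exact ⟨h1, h2, hE' h3⟩
    · intro i i' hii E hE E' hE'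
      have : tr j (E ∪ E') = tr j E ∪ tr j E' := by
        ext a
        simp only [tr, Finset.mem_filter, Finset.mem_union, mem_union]
        constructor
        · rintro ⟨h1, h2, h3 | h3⟩
          · exact Or.inl ⟨h1, h2, h3⟩
          · exact Or.inr ⟨h1, h2, h3⟩
        · rintro (⟨h1, h2, h3⟩ | ⟨h1, h2, h3⟩)
          · exact ⟨h1, h2, Or.inl h3⟩
          · exact ⟨h1, h2, Or.inr h3⟩
      simp only [cs, mem_ofPred_eq, this] at hE hE' ⊢
      rw [← hii] at hE hE'
      exact hdbl _ _ hE _ hE'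
  let f' : (Σ j, BlkS j) → ℕ := fun x =>
    if h : Q x.1 (k x.1) then r (k x.1) (x.2 ⟨cs x.1, hvalid x.1 h⟩).1 else 0
  refine ⟨fun a => f' (e.symm a), ?_, ?_⟩
  · intro n
    obtain ⟨M, hM⟩ := eventually_atTop.1 (hk (n+1))
    have hfin : (⋃ j ∈ Iio M, range (fun x : BlkS j => e ⟨j, x⟩)).Finite :=
      (finite_Iio M).biUnion fun j _ => finite_range _
    refine hfin.subset ?_
    intro a ha
    simp only [mem_iUnion, mem_range, mem_Iio]
    refine ⟨(e.symm a).1, ?_, (e.symm a).2, by simp⟩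
    by_contra hc
    obtain ⟨h1, h2⟩ := hM _ (not_lt.1 hc)
    have ha' : f' (e.symm a) = n := ha
    simp only [f', dif_pos h2] at ha'
    have := hFm _ _ (hr (k (e.symm a).1) ((e.symm a).2 ⟨cs (e.symm a).1, hvalid _ h2⟩).1)
    omega
  · intro A hAI n
    obtain ⟨m, hm⟩ := hbig n A hAI
    filter_upwards [hk m, eventually_gt_atTop n] with j hj hnj
    obtain ⟨hmk, hQ⟩ := hj
    refine ⟨hnj, fun c => if c.1 = cs j then {y | r (k j) y.1 ∈ A} else ∅, ?_, ?_⟩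
    · intro c
      dsimp only
      split_ifs with h
      · rw [h]
        refine hm _ ?_ ?_
        · intro a ha
          simp only [tr, Finset.coe_filter, mem_ofPred_eq] at ha
          obtain ⟨h1, h2, h3⟩ := ha
          simpa only [r, if_pos h1] using h3
        · intro a ha
          exact hmk.trans (hFm _ _ (Finset.mem_filter.1 ha).1)
      · exact c.2.1 _
    · intro x hx
      refine ⟨⟨cs j, hvalid j hQ⟩, ?_⟩
      have hx' : f' ⟨j, x⟩ ∈ A := by
        have h3 : f' (e.symm (e ⟨j, x⟩)) ∈ A := hx
        rwa [Equiv.symm_apply_apply] at h3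
      simp only [f', dif_pos hQ] at hx'
      simpa using hx'

lemma exists_equivS : Nonempty ((Σ j, BlkS j) ≃ ℕ) := by
  have : Infinite (Σ j, BlkS j) := by
    refine Infinite.of_injective (fun n : ℕ => (⟨n+1, fun _ => 0⟩ : Σ j, BlkS j)) ?_
    intro a b h
    have := congrArg Sigma.fst h
    simpa using this
  exact nonempty_equiv_of_countable

/-- Sakai: the family of analytic P-ideals on `ℕ` has a largest element in the
Katětov–Blass order. -/
theorem sakai_largest_analytic_pideal :
    ∃ J : Set (Set ℕ), IsIdeal J ∧ ContainsFin J ∧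
      MeasureTheory.AnalyticSet (chi '' J) ∧ IsPIdeal J ∧
      ∀ I : Set (Set ℕ), IsIdeal I → ContainsFin I →
        MeasureTheory.AnalyticSet (chi '' I) → IsPIdeal I → KatetovBlassLE I J := by
  obtain ⟨e⟩ := exists_equivS
  exact ⟨JS e, JS_ideal e, JS_fin e, JS_analytic e, JS_P e,
    fun I hI hfin hA hP => JS_max e hI hfin hA hP⟩
end

section
/- (Barbarski; Hrušák–Meza; Filipów et al.) Let I be an analytic P-ideal on ℕ. The following are equivalent: (i) conv is not Katětov below I (conv ≰_K I); (ii) I is FinBW; (iii) I can be extended to an Fσ ideal, i.e., there is an ideal J ⊇ I which is an Fσ subset of 2^ℕ. -/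
open Set Filter Topology

/-- The ideal `conv` on `ℚ ∩ [0,1]`. -/
def convIdeal : Set (Set ↥(Set.Icc (0 : ℚ) 1)) :=
  {A : Set ↥(Set.Icc (0 : ℚ) 1) |
    {x : ℝ | AccPt x (Filter.principal
      ((fun q : ↥(Set.Icc (0 : ℚ) 1) => ((q : ℚ) : ℝ)) '' A))}.Finite}

/-- `I` is FinBW. -/
def FinBW (I : Set (Set ℕ)) : Prop :=
  ∀ x : ℕ → ℝ, (∃ M : ℝ, ∀ n, |x n| ≤ M) →
    ∃ A : Set ℕ, A ∉ I ∧ ∃ l : ℝ, Tendsto (fun n : ↥A => x ↑n) cofinite (nhds l)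


def NN (s : List ℕ) : Set (ℕ → ℕ) := {y | PiNat.res y s.length = s}

lemma mem_NN_agree {s : List ℕ} {y z : ℕ → ℕ} (hy : y ∈ NN s) :
    z ∈ NN s ↔ ∀ k, k < s.length → z k = y k := by
  unfold NN at *
  simp only [mem_ofPred_eq] at *
  constructor
  · intro hz
    have : PiNat.res z s.length = PiNat.res y s.length := by rw [hz, hy]
    exact fun k hk => PiNat.res_eq_res.1 this hk
  · intro h
    have : PiNat.res z s.length = PiNat.res y s.length := PiNat.res_eq_res.2 (fun k hk => h k hk)
    rw [this, hy]

lemma mem_NN_res (y : ℕ → ℕ) (n : ℕ) : y ∈ NN (PiNat.res y n) := by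
  simp [NN]

/-- nested cylinders have a common point -/
lemma nested_point (s : ℕ → List ℕ) (hne : ∀ i, (NN (s i)).Nonempty)
    (hsub : ∀ i, NN (s (i+1)) ⊆ NN (s i)) (hlen : ∀ i, (s i).length < (s (i+1)).length) :
    ∃ x, ∀ i, x ∈ NN (s i) := by
  choose y hy using hne
  have hanti : Antitone (fun i => NN (s i)) := antitone_nat_of_succ_le hsub
  have hl : ∀ i, i ≤ (s i).length := by
    intro i
    induction i with
    | zero => omega
    | succ n ih => have := hlen n; omega
  refine ⟨fun k => y (k+1) k, fun i => (mem_NN_agree (hy i)).2 ?_⟩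
  intro k hk
  rcases le_total (k+1) i with h | h
  · have h1 : y i ∈ NN (s (k+1)) := hanti h (hy i)
    exact ((mem_NN_agree (hy (k+1))).1 h1 k (by have := hl (k+1); omega)).symm
  · have h1 : y (k+1) ∈ NN (s i) := hanti h (hy (k+1))
    exact (mem_NN_agree (hy i)).1 h1 k hk

lemma chi_eq_true {A : Set ℕ} {k : ℕ} : chi A k = true ↔ k ∈ A := by
  simp [chi]

def Cof (I : Set (Set ℕ)) (f : (ℕ → ℕ) → (ℕ → Bool)) (V : Set (ℕ → ℕ)) : Prop :=
  ∀ A ∈ I, ∃ y ∈ V, ∃ m, ∀ k ∈ A, m ≤ k → f y k = true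

lemma Cof_sigma {I : Set (Set ℕ)} {f : (ℕ → ℕ) → (ℕ → Bool)} (hP : IsPIdeal I)
    {ι : Type*} [Countable ι] [Nonempty ι] (V : ι → Set (ℕ → ℕ)) (h : ∀ i, ¬ Cof I f (V i)) :
    ¬ Cof I f (⋃ i, V i) := by
  intro hc
  obtain ⟨e, he⟩ := exists_surjective_nat ι
  unfold Cof at h
  push Not at h
  choose A hA hA' using h
  obtain ⟨F, hF, hF'⟩ := hP (fun n => A (e n)) (fun n => hA _)
  obtain ⟨y, hy, m, hm⟩ := hc F hF
  obtain ⟨i, hi⟩ := mem_iUnion.1 hy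
  obtain ⟨n, rfl⟩ := he i
  obtain ⟨b, hb⟩ := (hF' n).bddAbove
  obtain ⟨k, hk, hk1, hk2⟩ := hA' (e n) y hi (max m (b+1))
  apply hk2
  refine hm k ?_ (by omega)
  by_contra hkF
  have := hb (show k ∈ A (e n) \ F from ⟨hk, hkF⟩)
  omega

lemma core (I : Set (Set ℕ)) (hI : IsIdeal I)
    (hfin : ContainsFin I) (hA : MeasureTheory.AnalyticSet (chi '' I))
    (hP : IsPIdeal I) : ∃ X : ℕ → Set (ℕ → Bool), (∀ j, IsClosed (X j)) ∧
      (∀ j, ∀ A ∈ I, ∃ B ∈ X j, ∃ m : ℕ, ∀ k ∈ A, m ≤ k → B k = true) ∧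
      ∀ A : Set ℕ, (∀ j, ∃ B ∈ X j, ∃ m : ℕ, ∀ k ∈ A, m ≤ k → B k = true) → A ∈ I := by
  obtain ⟨hI0, hI1, hIu, hIs⟩ := hI
  rw [MeasureTheory.AnalyticSet] at hA
  rcases hA with hA | ⟨f, hf, hfr⟩
  · exact absurd (mem_image_of_mem chi hI0) (by rw [hA]; simp)
  have hfI : ∀ x, {k | f x k = true} ∈ I := by
    intro x
    have : f x ∈ chi '' I := hfr ▸ mem_range_self x
    obtain ⟨A, hA, hAx⟩ := this
    rw [← hAx]
    simpa [chi_eq_true] using hA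
  set G : Set (ℕ → ℕ) := {x | ∀ n, Cof I f (NN (PiNat.res x n))} with hG
  have hcofuniv : Cof I f (NN []) := by
    intro A hA
    have : chi A ∈ range f := hfr ▸ mem_image_of_mem chi hA
    obtain ⟨y, hy⟩ := this
    refine ⟨y, by simp [NN], 0, fun k hk _ => ?_⟩
    rw [hy, chi_eq_true]; exact hk
  have hcofG : ∀ s, Cof I f (NN s) → Cof I f (NN s ∩ G) := by
    classical
    intro s hs
    by_contra hcon
    let V : Option (List ℕ) → Set (ℕ → ℕ) := fun o => o.elim (NN s ∩ G)
      (fun t => if Cof I f (NN t) then ∅ else NN t)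
    have hV : ∀ o, ¬ Cof I f (V o) := by
      rintro (_ | t)
      · exact hcon
      · simp only [V, Option.elim]
        split_ifs with h
        · intro h'
          obtain ⟨y, hy, _⟩ := h' ∅ hI0
          exact hy
        · exact h
    apply Cof_sigma hP V hV
    intro A hA
    obtain ⟨y, hy, m, hm⟩ := hs A hA
    refine ⟨y, ?_, m, hm⟩
    by_cases hyG : y ∈ G
    · exact mem_iUnion.2 ⟨none, hy, hyG⟩
    · simp only [hG, mem_ofPred_eq, not_forall] at hyG
      obtain ⟨n, hn⟩ := hyG
      refine mem_iUnion.2 ⟨some (PiNat.res y n), ?_⟩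
      simp only [V, Option.elim, if_neg hn]
      exact mem_NN_res y n
  let S := {s : List ℕ // Cof I f (NN s)}
  have : Nonempty S := ⟨⟨[], hcofuniv⟩⟩
  obtain ⟨e, he⟩ := exists_surjective_nat S
  refine ⟨fun j => closure (f '' (NN (e j).1 ∩ G)), fun j => isClosed_closure, ?_, ?_⟩
  · intro j A hA
    obtain ⟨y, hy, m, hm⟩ := hcofG _ (e j).2 A hA
    exact ⟨f y, subset_closure (mem_image_of_mem f hy), m, hm⟩
  intro A hAj
  have hAS : ∀ s : S, ∃ m : ℕ, s.1.length ≤ m ∧ ∃ B ∈ closure (f '' (NN s.1 ∩ G)),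
      ∀ k ∈ A, m ≤ k → B k = true := by
    intro s
    obtain ⟨j, rfl⟩ := he s
    obtain ⟨B, hB, m, hm⟩ := hAj j
    exact ⟨max m _, le_max_right _ _, B, hB, fun k hk hmk => hm k hk (le_trans (le_max_left _ _) hmk)⟩
  choose m hml hm using hAS
  have hstep : ∀ (s : S) (b : ℕ), ∃ s' : S, NN s'.1 ⊆ NN s.1 ∧ s.1.length < s'.1.length ∧
      ∀ z ∈ NN s'.1, ∀ k ∈ A, m s ≤ k → k < b → f z k = true := by
    intro s b
    obtain ⟨B, hB, hBA⟩ := hm s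
    have hopen : ∀ C : ℕ → Bool, IsOpen {D : ℕ → Bool | ∀ k ∈ Finset.range b, D k = C k} := by
      intro C
      have : {D : ℕ → Bool | ∀ k ∈ Finset.range b, D k = C k} =
        ⋂ k ∈ Finset.range b, {D : ℕ → Bool | D k = C k} := by
        ext; simp
      rw [this]
      refine isOpen_biInter_finset (fun k _ => ?_)
      have hc : Continuous (fun D : ℕ → Bool => D k) := continuous_apply k
      exact (isOpen_discrete ({C k} : Set Bool)).preimage hc
    obtain ⟨_, hD, y, ⟨hys, hyG⟩, rfl⟩ := mem_closure_iff.1 hB _ (hopen B) (by simp)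
    have hnh : f ⁻¹' {D : ℕ → Bool | ∀ k ∈ Finset.range b, D k = f y k} ∈ 𝓝 y :=
      ((hopen (f y)).preimage hf).mem_nhds (by simp)
    obtain ⟨_, ⟨⟨x, n, rfl⟩, hx1, hx2⟩⟩ :=
      (PiNat.isTopologicalBasis_cylinders (fun _ : ℕ => ℕ)).mem_nhds_iff.1 hnh
    have hxy : ∀ k, k < n → y k = x k := fun k hk => hx1 k hk
    set N := max n (s.1.length + 1) with hN
    refine ⟨⟨PiNat.res y N, hyG N⟩, ?_, ?_, ?_⟩
    · intro z hz
      rw [mem_NN_agree (mem_NN_res y N)] at hz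
      rw [mem_NN_agree hys]
      intro k hk
      exact hz k (by simp [PiNat.res_length]; omega)
    · simp only [PiNat.res_length]; omega
    · intro z hz k hk hmk hkb
      rw [mem_NN_agree (mem_NN_res y N)] at hz
      simp only [PiNat.res_length] at hz
      have hzx : z ∈ PiNat.cylinder x n := by
        intro k hk
        rw [hz k (by omega), hxy k hk]
      have h1 := hx2 hzx k (by simpa using hkb)
      rw [h1, hD k (by simpa using hkb)]
      exact hBA k hk hmk
  choose step hsub hlen hcov using hstep
  let s0 : S := ⟨[], hcofuniv⟩
  let p : ℕ → S × S := fun j => Nat.rec (s0, s0) (fun _ q => (q.2, step q.1 (m q.2))) j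
  let u : ℕ → S := fun j => (p j).1
  have hp2 : ∀ j, (p j).2 = u (j+1) := fun j => rfl
  have hu : ∀ j, u (j+2) = step (u j) (m (u (j+1))) := fun j => rfl
  have hne : ∀ s : S, (NN s.1).Nonempty := fun s => by
    obtain ⟨y, hy, _⟩ := s.2 ∅ hI0
    exact ⟨y, hy⟩
  obtain ⟨x, hx⟩ := nested_point (fun i => (u (2*i)).1) (fun i => hne _)
    (fun i => by rw [show 2*(i+1) = 2*i+2 by ring, hu]; exact hsub _ _)
    (fun i => by rw [show 2*(i+1) = 2*i+2 by ring, hu]; exact hlen _ _)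
  obtain ⟨z, hz⟩ := nested_point (fun i => (u (2*i+1)).1) (fun i => hne _)
    (fun i => by rw [show 2*(i+1)+1 = 2*i+1+2 by ring, hu (2*i+1)]; exact hsub _ _)
    (fun i => by rw [show 2*(i+1)+1 = 2*i+1+2 by ring, hu (2*i+1)]; exact hlen _ _)
  have hlu : ∀ i, i ≤ (u (2*i)).1.length := by
    intro i
    induction i with
    | zero => omega
    | succ n ih =>
      have := hlen (u (2*n)) (m (u (2*n+1)))
      rw [show 2*(n+1) = 2*n+2 by ring, hu]; omega
  have hmain : A ⊆ (Set.Iio (m (u 0)) ∪ {k | f x k = true}) ∪ {k | f z k = true} := by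
    intro k hk
    by_cases hk0 : k < m (u 0)
    · exact Or.inl (Or.inl hk0)
    have hex : ∃ j, k < m (u j) := by
      refine ⟨2*(k+1), ?_⟩
      have := hlu (k+1); have := hml (u (2*(k+1))); omega
    classical
    obtain ⟨j, hj⟩ : ∃ j, Nat.find hex = j + 1 := by
      refine ⟨Nat.find hex - 1, ?_⟩
      have : Nat.find hex ≠ 0 := by
        intro h
        have := Nat.find_spec hex
        rw [h] at this; exact hk0 this
      omega
    have h1 : k < m (u (j+1)) := hj ▸ Nat.find_spec hex
    have h2 : m (u j) ≤ k := not_lt.1 (Nat.find_min hex (by omega))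
    have h3 : ∀ w ∈ NN (u (j+2)).1, f w k = true := by
      intro w hw
      rw [hu] at hw
      exact hcov _ _ w hw k hk h2 h1
    rcases Nat.even_or_odd' j with ⟨i, rfl | rfl⟩
    · exact Or.inl (Or.inr (h3 x (hx (i+1))))
    · exact Or.inr (h3 z (hz (i+1)))
  exact hIs _ _ hmain (hIu _ _ (hIu _ _ (hfin _ (Set.finite_Iio _)) (hfI x)) (hfI z))

lemma chi_setOf (a : ℕ → Bool) : chi {k | a k = true} = a := by
  funext k
  rw [Bool.eq_iff_iff, chi_eq_true]
  simp

def JJ (X : Set (ℕ → Bool)) : Set (Set ℕ) :=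
  {A | ∃ n m : ℕ, ∃ B : Fin n → (ℕ → Bool), (∀ i, B i ∈ X) ∧
    ∀ k ∈ A, m ≤ k → ∃ i, B i k = true}

lemma JJ_fsigma {X : Set (ℕ → Bool)} (hX : IsClosed X) : IsFsigma (chi '' JJ X) := by
  let D : ℕ → ℕ → Set ((ℕ → Bool) × (ℕ → ℕ → Bool)) := fun n m =>
    {p | (∀ i ∈ Set.Iio n, p.2 i ∈ X) ∧
      ∀ k, m ≤ k → (p.1 k = false ∨ ∃ i ∈ Set.Iio n, p.2 i k = true)}
  have hb : ∀ (g : ((ℕ → Bool) × (ℕ → ℕ → Bool)) → Bool) (b : Bool), Continuous g →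
      IsClosed {p | g p = b} := fun g b hg => isClosed_eq hg continuous_const
  have hD : ∀ n m, IsClosed (D n m) := by
    intro n m
    have : D n m = (⋂ i ∈ Set.Iio n, {p | p.2 i ∈ X}) ∩ ⋂ k ∈ Set.Ici m,
        ({p : (ℕ → Bool) × (ℕ → ℕ → Bool) | p.1 k = false} ∪
          ⋃ i ∈ Set.Iio n, {p : (ℕ → Bool) × (ℕ → ℕ → Bool) | p.2 i k = true}) := by
      ext p; simp [D]
    rw [this]
    refine IsClosed.inter (isClosed_biInter fun i _ => ?_) (isClosed_biInter fun k _ => ?_)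
    · exact hX.preimage (by fun_prop : Continuous
        (fun p : (ℕ → Bool) × (ℕ → ℕ → Bool) => p.2 i))
    · refine IsClosed.union (hb _ _ (by fun_prop)) ?_
      exact (Set.finite_Iio n).isClosed_biUnion fun i _ => hb _ _ (by fun_prop)
  refine ⟨fun j => Prod.fst '' (D (Nat.unpair j).1 (Nat.unpair j).2),
    fun j => isClosedMap_fst_of_compactSpace _ (hD _ _), ?_⟩
  ext a
  simp only [mem_image, mem_iUnion]
  constructor
  · rintro ⟨A, ⟨n, m, B, hB, hBA⟩, rfl⟩
    refine ⟨Nat.pair n m, (chi A, fun i => if h : i < n then B ⟨i, h⟩ else fun _ => false), ?_, rfl⟩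
    simp only [Nat.unpair_pair]
    refine ⟨fun i hi => ?_, fun k hk => ?_⟩
    · have hi' : i < n := hi
      simp [hi', hB]
    · by_cases hkA : k ∈ A
      · right
        obtain ⟨i, hi⟩ := hBA k hkA hk
        exact ⟨i, i.2, by simpa using hi⟩
      · left
        rw [← Bool.not_eq_true, chi_eq_true]; exact hkA
  · rintro ⟨j, ⟨a, b⟩, ⟨h1, h2⟩, rfl⟩
    refine ⟨{k | a k = true}, ⟨_, (Nat.unpair j).2, fun i => b i, fun i => h1 i i.2, ?_⟩, chi_setOf a⟩
    intro k hk hmk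
    rcases h2 k hmk with h | ⟨i, hi, h⟩
    · have hk' : a k = true := hk
      simp_all
    · exact ⟨⟨i, hi⟩, h⟩

lemma JJ_union {X : Set (ℕ → Bool)} {A B : Set ℕ} (hA : A ∈ JJ X) (hB : B ∈ JJ X) :
    A ∪ B ∈ JJ X := by
  obtain ⟨n, m, C, hC, hCA⟩ := hA
  obtain ⟨n', m', C', hC', hCA'⟩ := hB
  refine ⟨n + n', max m m', Fin.append C C', ?_, ?_⟩
  · intro i
    refine Fin.addCases (fun i => ?_) (fun i => ?_) i
    · simpa using hC i
    · simpa using hC' i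
  · rintro k (hk | hk) hm
    · obtain ⟨i, hi⟩ := hCA k hk (le_trans (le_max_left _ _) hm)
      exact ⟨Fin.castAdd _ i, by simpa using hi⟩
    · obtain ⟨i, hi⟩ := hCA' k hk (le_trans (le_max_right _ _) hm)
      exact ⟨Fin.natAdd _ i, by simpa using hi⟩

lemma finbw_sets {I : Set (Set ℕ)} (h : FinBW I) (C : ℕ → Set ℕ) :
    ∃ A, A ∉ I ∧ ∀ m, (A \ C m).Finite ∨ (A ∩ C m).Finite := by
  let φ := cantorSetHomeomorphNatToBool
  let w : ℕ → (ℕ → Bool) := fun n m => chi (C m) n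
  obtain ⟨A, hA, l, hl⟩ := h (fun n => (φ.symm (w n) : ℝ)) ⟨1, fun n => by
    have := cantorSet_subset_unitInterval (φ.symm (w n)).2
    rw [abs_le]; constructor <;> linarith [this.1, this.2]⟩
  refine ⟨A, hA, ?_⟩
  by_cases hfin : A.Finite
  · exact fun m => Or.inl (hfin.subset sdiff_subset)
  have hinf : Infinite A := Set.infinite_coe_iff.2 hfin
  have hlC : l ∈ cantorSet := isClosed_cantorSet.mem_of_tendsto hl
    (Eventually.of_forall fun n => (φ.symm (w n)).2)
  have h1 : Tendsto (fun n : A => φ.symm (w n)) cofinite (𝓝 ⟨l, hlC⟩) :=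
    tendsto_subtype_rng.2 hl
  have h2 : Tendsto (fun n : A => w n) cofinite (𝓝 (φ ⟨l, hlC⟩)) := by
    have := (φ.continuous.tendsto _).comp h1
    simpa [Function.comp_def] using this
  intro m
  have h3 := tendsto_pi_nhds.1 h2 m
  rw [nhds_discrete, tendsto_pure] at h3
  have h4 := h3.image Subtype.val
  cases hb : φ ⟨l, hlC⟩ m with
  | true =>
    left
    refine h4.subset ?_
    rintro k ⟨hk, hkC⟩
    refine ⟨⟨k, hk⟩, ?_, rfl⟩
    simp [hb, w, chi, hkC]
  | false =>
    right
    refine h4.subset ?_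
    rintro k ⟨hk, hkC⟩
    refine ⟨⟨k, hk⟩, ?_, rfl⟩
    simp [hb, w, chi, hkC]

lemma finbw_of_fsigma {J : Set (Set ℕ)} (hJ : IsIdeal J) (hF : IsFsigma (chi '' J)) : FinBW J := by
  obtain ⟨hJ0, hJ1, hJu, hJs⟩ := hJ
  obtain ⟨F, hFc, hFJ⟩ := hF
  rintro x ⟨M, hM⟩
  let 𝓕 : Filter ℕ :=
    { sets := {A | Aᶜ ∈ J}
      univ_sets := by simpa using hJ0
      sets_of_superset := fun {A B} hA hAB => hJs _ _ (compl_subset_compl.2 hAB) hA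
      inter_sets := fun {A B} hA hB => by
        have := hJu _ _ hA hB
        rw [← compl_inter] at this
        exact this }
  have hmem : ∀ A, A ∈ 𝓕 ↔ Aᶜ ∈ J := fun A => Iff.rfl
  have hne : 𝓕.NeBot := by
    refine ⟨fun h => hJ1 ?_⟩
    have : (∅ : Set ℕ) ∈ 𝓕 := by rw [h]; trivial
    rw [hmem] at this; simpa using this
  obtain ⟨l, -, hl⟩ := (isCompact_Icc (a := -M) (b := M)).exists_mapClusterPt (f := 𝓕) (u := x)
    (le_principal_iff.2 (mem_map.2 (Filter.mem_of_superset Filter.univ_mem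
      (fun n _ => abs_le.1 (hM n)))))
  rw [mapClusterPt_iff_frequently] at hl
  let A : ℕ → Set ℕ := fun k => {n | dist (x n) l < 1 / ((k : ℝ) + 1)}
  have hAJ : ∀ k, A k ∉ J := by
    intro k hk
    have hlk := hl (Metric.ball l (1 / ((k : ℝ) + 1))) (Metric.ball_mem_nhds _ (by positivity))
    apply hlk
    change {n | ¬ (x n ∈ Metric.ball l (1 / ((k : ℝ) + 1)))} ∈ 𝓕
    rw [hmem]
    refine hJs _ _ ?_ hk
    intro n hn
    simpa [A] using hn
  have hAanti : Antitone A := by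
    intro i j hij n hn
    have hn' : dist (x n) l < 1 / ((j : ℝ) + 1) := hn
    exact lt_of_lt_of_le hn' (one_div_le_one_div_of_le (by positivity) (by
      have : (i : ℝ) ≤ j := by exact_mod_cast hij
      linarith))
  have key : ∀ k, ∃ b : ℕ, ∀ B ∈ F k, ∃ n ∈ A k, n < b ∧ B n = false := by
    intro k
    by_contra hcon
    push Not at hcon
    let t : ℕ → Set (ℕ → Bool) := fun b => F k ∩ ⋂ n ∈ {n | n ∈ A k ∧ n < b}, {B | B n = true}
    have htc : ∀ b, IsClosed (t b) := fun b =>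
      (hFc k).inter (isClosed_biInter fun n _ => isClosed_eq (continuous_apply n) continuous_const)
    obtain ⟨B, hB⟩ := IsCompact.nonempty_iInter_of_sequence_nonempty_isCompact_isClosed t
      (fun b B hB => ⟨hB.1, by
        have := hB.2
        simp only [mem_iInter] at this ⊢
        exact fun n hn => this n ⟨hn.1, by have := hn.2; omega⟩⟩)
      (fun b => by
        obtain ⟨B, hB, hB'⟩ := hcon b
        refine ⟨B, hB, ?_⟩
        simp only [mem_iInter]
        intro n hn
        have := hB' n hn.1 hn.2
        simpa using this)
      (htc 0).isCompact htc
    rw [mem_iInter] at hB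
    have hBJ : B ∈ chi '' J := hFJ ▸ mem_iUnion.2 ⟨k, (hB 0).1⟩
    obtain ⟨B', hB', rfl⟩ := hBJ
    refine hAJ k (hJs _ _ ?_ hB')
    intro n hn
    have := (hB (n+1)).2
    simp only [mem_iInter] at this
    exact chi_eq_true.1 (this n ⟨hn, by omega⟩)
  choose b hb using key
  refine ⟨⋃ k, (A k ∩ Set.Iio (b k)), ?_, l, ?_⟩
  · intro hU
    have : chi (⋃ k, (A k ∩ Set.Iio (b k))) ∈ ⋃ n, F n := hFJ ▸ mem_image_of_mem chi hU
    obtain ⟨k, hk⟩ := mem_iUnion.1 this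
    obtain ⟨n, hn, hnb, hf⟩ := hb k _ hk
    rw [← Bool.not_eq_true, chi_eq_true] at hf
    exact hf (mem_iUnion.2 ⟨k, hn, hnb⟩)
  · rw [Metric.tendsto_nhds]
    intro ε hε
    obtain ⟨k, hk⟩ := exists_nat_one_div_lt hε
    rw [eventually_cofinite]
    apply Set.Finite.of_finite_image (f := Subtype.val) _ Subtype.val_injective.injOn
    refine ((Set.finite_Iio k).biUnion fun i _ => Set.finite_Iio (b i)).subset ?_
    rintro _ ⟨⟨n, hn⟩, hn', rfl⟩
    obtain ⟨i, hi, hib⟩ := mem_iUnion.1 hn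
    have hik : i < k := by
      by_contra h
      apply hn'
      have : n ∈ A k := hAanti (not_lt.1 h) hi
      exact lt_trans this hk
    exact mem_biUnion hik hib

lemma inj_choice {α : Type*} (S : ℕ → Set α) (hS : ∀ n, (S n).Infinite) :
    ∃ f : ℕ → α, Function.Injective f ∧ ∀ n, f n ∈ S n := by
  classical
  have : ∀ n (s : Finset α), ∃ a, a ∈ S n ∧ a ∉ s := fun n s => (hS n).exists_notMem_finset s
  choose c hc hc' using this
  let F : ℕ → Finset α := fun n => Nat.rec ∅ (fun n s => insert (c n s) s) n
  have hF : ∀ n, F (n+1) = insert (c n (F n)) (F n) := fun n => rfl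
  have hmono : Monotone F := monotone_nat_of_le_succ fun n => by
    rw [hF]; exact Finset.subset_insert _ _
  have hlt : ∀ m n, m < n → c m (F m) ≠ c n (F n) := by
    intro m n hmn h
    apply hc' n (F n)
    rw [← h]
    apply hmono (show m + 1 ≤ n from hmn)
    rw [hF]; exact Finset.mem_insert_self _ _
  refine ⟨fun n => c n (F n), ?_, fun n => hc _ _⟩
  intro m n h
  rcases lt_trichotomy m n with h' | h' | h'
  · exact absurd h (hlt _ _ h')
  · exact h'
  · exact absurd h.symm (hlt _ _ h')

lemma not_katetov_of_finbw {I : Set (Set ℕ)} (hI : IsIdeal I) (h : FinBW I) :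
    ¬ KatetovLE convIdeal I := by
  rintro ⟨f, hf⟩
  obtain ⟨hI0, hI1, hIu, hIs⟩ := hI
  obtain ⟨A, hA, l, hl⟩ := h (fun n => (((f n : ℚ)) : ℝ)) ⟨1, fun n => by
    have h1 : ((0 : ℚ) : ℝ) ≤ ((f n : ℚ) : ℝ) := by exact_mod_cast (f n).2.1
    have h2 : ((f n : ℚ) : ℝ) ≤ ((1 : ℚ) : ℝ) := by exact_mod_cast (f n).2.2
    push_cast at h1 h2
    rw [abs_le]; constructor <;> linarith⟩
  apply hA
  refine hIs _ _ (subset_preimage_image f A) (hf _ ?_)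
  refine (Set.finite_singleton l).subset ?_
  intro y hy
  by_contra hyl
  have hyl' : y ≠ l := hyl
  obtain ⟨U, V, hU, hV, hyU, hlV, hUV⟩ := t2_separation hyl'
  have hy' : AccPt y (𝓟 ((fun q : ↥(Set.Icc (0 : ℚ) 1) => ((q : ℚ) : ℝ)) '' (f '' A))) := hy
  have hev := hl (hV.mem_nhds hlV)
  have hfinA : {n : A | ¬ (((f n : ℚ) : ℝ) ∈ V)}.Finite := hev
  have hfin2 := hfinA.image (fun n : A => ((f n : ℚ) : ℝ))
  have hinf := accPt_iff_frequently.1 hy'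
  have hfin3 : (((fun n : A => ((f n : ℚ) : ℝ)) '' {n : A | ¬ (((f n : ℚ) : ℝ) ∈ V)}) \ {y}).Finite :=
    hfin2.subset sdiff_subset
  have hnh : U ∩ (((fun n : A => ((f n : ℚ) : ℝ)) '' {n : A | ¬ (((f n : ℚ) : ℝ) ∈ V)}) \ {y})ᶜ ∈ 𝓝 y :=
    inter_mem (hU.mem_nhds hyU) (hfin3.isClosed.isOpen_compl.mem_nhds (by simp))
  obtain ⟨z, ⟨hzy, hz⟩, hzU, hz2⟩ := (hinf.and_eventually hnh).exists
  obtain ⟨_, ⟨n, hn, rfl⟩, rfl⟩ := hz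
  apply hz2
  refine ⟨⟨⟨n, hn⟩, ?_, rfl⟩, hzy⟩
  exact fun hzV => (Set.disjoint_left.1 hUV) hzU hzV

lemma infinite_near (y ε : ℝ) (hε : 0 < ε) (hy0 : 0 < y) (hy1 : y < 1) :
    {q : ↥(Set.Icc (0 : ℚ) 1) | |((q : ℚ) : ℝ) - y| < ε}.Infinite := by
  obtain ⟨a, ha1, ha2⟩ := exists_rat_btwn (show max 0 (y - ε) < y by
    apply max_lt <;> linarith)
  obtain ⟨b, hb1, hb2⟩ := exists_rat_btwn (show y < min 1 (y + ε) by
    apply lt_min <;> linarith)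
  have hab : a < b := by exact_mod_cast ha2.trans hb1
  apply Set.Infinite.of_image Subtype.val
  refine (Set.Ioo_infinite hab).mono ?_
  rintro q ⟨hq1, hq2⟩
  have h1 : (a : ℝ) < q := by exact_mod_cast hq1
  have h2 : (q : ℝ) < b := by exact_mod_cast hq2
  have h3 := (max_lt_iff.1 ha1)
  have h4 := (lt_min_iff.1 hb2)
  have h5 : (0 : ℝ) ≤ q := by linarith [h3.1]
  have h6 : (q : ℝ) ≤ 1 := by linarith [h4.1]
  refine ⟨⟨q, by exact_mod_cast h5, by exact_mod_cast h6⟩, ?_, rfl⟩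
  simp only [mem_ofPred_eq]
  rw [abs_lt]; constructor <;> linarith [h3.2, h4.2]

lemma katetov_of_not_finbw {I : Set (Set ℕ)} (hI : IsIdeal I) (hfin : ContainsFin I)
    (h : ¬ FinBW I) : KatetovLE convIdeal I := by
  obtain ⟨hI0, hI1, hIu, hIs⟩ := hI
  unfold FinBW at h
  push Not at h
  obtain ⟨x, ⟨M, hM⟩, hx⟩ := h
  set M' := |M| + 1 with hM'
  have hMpos : 0 < M' := by positivity
  have hxM : ∀ n, |x n| < M' := fun n => lt_of_le_of_lt (hM n) (by
    have := le_abs_self M; linarith)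
  let y : ℕ → ℝ := fun n => (x n + M') / (2 * M')
  have hy0 : ∀ n, 0 < y n := fun n => by
    have := (abs_lt.1 (hxM n)).1
    exact div_pos (by linarith) (by linarith)
  have hy1 : ∀ n, y n < 1 := fun n => by
    have := (abs_lt.1 (hxM n)).2
    exact (div_lt_one (by linarith)).2 (by linarith)
  have hxy : ∀ n, x n = y n * (2 * M') - M' := fun n => by
    simp only [y]; field_simp; ring
  obtain ⟨f, hfinj, hf⟩ := inj_choice
    (fun n => {q : ↥(Set.Icc (0 : ℚ) 1) | |((q : ℚ) : ℝ) - y n| < 1 / ((n : ℝ) + 1)})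
    (fun n => infinite_near _ _ (by positivity) (hy0 n) (hy1 n))
  refine ⟨f, fun E hE => ?_⟩
  set ι : ↥(Set.Icc (0 : ℚ) 1) → ℝ := fun q => ((q : ℚ) : ℝ) with hι
  have hιinj : Function.Injective ι := fun p q hpq => by
    have : ((p : ℚ) : ℝ) = ((q : ℚ) : ℝ) := hpq
    exact Subtype.ext (by exact_mod_cast this)
  let g : ℕ → ℝ := fun n => ι (f n)
  have hginj : Function.Injective g := hιinj.comp hfinj
  have hg01 : ∀ n, g n ∈ Set.Icc (0 : ℝ) 1 := fun n => by
    have h1 := (f n).2.1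
    have h2 := (f n).2.2
    exact ⟨by simp only [g, hι]; exact_mod_cast h1, by simp only [g, hι]; exact_mod_cast h2⟩
  have hgy : Tendsto (fun n => g n - y n) cofinite (𝓝 0) := by
    rw [Nat.cofinite_eq_atTop]
    refine squeeze_zero_norm (fun n => ?_) tendsto_one_div_add_atTop_nhds_zero_nat
    exact (hf n).le
  set L : Set ℝ := {z | AccPt z (𝓟 (ι '' E))} with hL
  have hLfin : L.Finite := hE
  have hacc : ∀ T : Set ℕ, T ⊆ f ⁻¹' E → ∀ K : Set ℝ, IsCompact K → g '' T ⊆ K → T.Infinite →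
      ∃ l ∈ K, l ∈ L ∧ AccPt l (𝓟 (g '' T)) := by
    intro T hT K hK hTK hTi
    obtain ⟨l, hl, hl'⟩ := (hTi.image hginj.injOn).exists_accPt_of_subset_isCompact hK hTK
    refine ⟨l, hl, ?_, hl'⟩
    refine hl'.mono (principal_mono.2 ?_)
    rintro _ ⟨n, hn, rfl⟩
    exact mem_image_of_mem ι (hT hn)
  have hr : ∀ l : ℝ, ∃ r : ℝ, 0 < r ∧ ∀ z ∈ Metric.closedBall l r, z ∈ L → z = l := by
    intro l
    have : (L \ {l})ᶜ ∈ 𝓝 l :=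
      (hLfin.subset sdiff_subset).isClosed.isOpen_compl.mem_nhds (by simp)
    obtain ⟨r, hr, hrs⟩ := Metric.nhds_basis_closedBall.mem_iff.1 this
    refine ⟨r, hr, fun z hz hzL => ?_⟩
    by_contra hne
    exact hrs hz ⟨hzL, hne⟩
  choose r hr0 hr using hr
  let Bl : ℝ → Set ℕ := fun l => f ⁻¹' E ∩ g ⁻¹' (Metric.closedBall l (r l))
  have hBl : ∀ l, Bl l ∈ I := by
    intro l
    by_contra hBI
    have hgl : Tendsto (fun n : Bl l => g n) cofinite (𝓝 l) := by
      rw [tendsto_nhds]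
      intro U hU hlU
      by_contra hcon
      have hcon' : {n : Bl l | g n ∉ U}.Infinite := hcon
      have hinf := hcon'.image (f := Subtype.val) Subtype.val_injective.injOn
      obtain ⟨l', hl', hl'L, -⟩ := hacc _ (by rintro _ ⟨n, -, rfl⟩; exact n.2.1)
        (Metric.closedBall l (r l) ∩ Uᶜ) ((isCompact_closedBall _ _).inter_right hU.isClosed_compl)
        (by rintro _ ⟨_, ⟨n, hn, rfl⟩, rfl⟩; exact ⟨n.2.2, hn⟩) hinf
      have := hr l l' hl'.1 hl'L
      rw [this] at hl'
      exact hl'.2 hlU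
    have hyl : Tendsto (fun n : Bl l => y n) cofinite (𝓝 l) := by
      have h1 : Tendsto (fun n : Bl l => g n - y n) cofinite (𝓝 0) :=
        hgy.comp Subtype.val_injective.tendsto_cofinite
      have := hgl.sub h1
      simpa using this
    refine hx (Bl l) hBI (l * (2 * M') - M') ?_
    have := (hyl.mul_const (2 * M')).sub_const M'
    simpa only [hxy] using this
  have hR : (f ⁻¹' E \ ⋃ l ∈ L, Bl l).Finite := by
    by_contra hinf
    obtain ⟨l, -, hlL, hl⟩ := hacc _ sdiff_subset (Set.Icc 0 1) isCompact_Icc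
      (by rintro _ ⟨n, -, rfl⟩; exact hg01 n) hinf
    obtain ⟨_, ⟨-, n, hn, rfl⟩, hz⟩ := ((accPt_iff_frequently.1 hl).and_eventually
      (Metric.closedBall_mem_nhds l (hr0 l))).exists
    exact hn.2 (mem_biUnion hlL ⟨hn.1, hz⟩)
  have hU : ∀ L' : Set ℝ, L'.Finite → (⋃ l ∈ L', Bl l) ∈ I := by
    intro L' hL'
    induction L', hL' using Set.Finite.induction_on with
    | empty => simpa using hI0
    | insert _ _ ih => rw [biUnion_insert]; exact hIu _ _ (hBl _) ih
  refine hIs _ _ ?_ (hIu _ _ (hfin _ hR) (hU L hLfin))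
  intro n hn
  by_cases hn' : n ∈ ⋃ l ∈ L, Bl l
  · exact Or.inr hn'
  · exact Or.inl ⟨hn, hn'⟩

/-- Barbarski; Hrušák–Meza; Filipów et al.: for an analytic P-ideal `I` the
following are equivalent: `conv ≰_K I`; `I` is FinBW; `I` extends to an `Fσ` ideal. -/
theorem analytic_pideal_conv_finbw_fsigma (I : Set (Set ℕ)) (hI : IsIdeal I)
    (hfin : ContainsFin I) (hA : MeasureTheory.AnalyticSet (chi '' I))
    (hP : IsPIdeal I) :
    (¬ KatetovLE convIdeal I ↔ FinBW I) ∧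
    (FinBW I ↔ ∃ J : Set (Set ℕ), IsIdeal J ∧ I ⊆ J ∧ IsFsigma (chi '' J)) := by
  have hI' := hI
  obtain ⟨hI0, hI1, hIu, hIs⟩ := hI
  refine ⟨⟨fun h => ?_, not_katetov_of_finbw hI'⟩, fun h => ?_, ?_⟩
  · by_contra hn
    exact h (katetov_of_not_finbw hI' hfin hn)
  · obtain ⟨X, hXc, hX1, hX2⟩ := core I hI' hfin hA hP
    by_contra hcon
    have hall : ∀ j, (Set.univ : Set ℕ) ∈ JJ (X j) := by
      intro j
      by_contra hj
      refine hcon ⟨JJ (X j), ⟨?_, hj, fun A B => JJ_union, ?_⟩, ?_, JJ_fsigma (hXc j)⟩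
      · exact ⟨0, 0, Fin.elim0, fun i => i.elim0, fun k hk => absurd hk (by simp)⟩
      · rintro A B hAB ⟨n, m, C, hC, hCB⟩
        exact ⟨n, m, C, hC, fun k hk => hCB k (hAB hk)⟩
      · intro A hA
        obtain ⟨B, hB, m, hm⟩ := hX1 j A hA
        exact ⟨1, m, fun _ => B, fun _ => hB, fun k hk hmk => ⟨0, hm k hk hmk⟩⟩
    choose n m B hB hBu using hall
    let C : Option (Σ j, Fin (n j)) → Set ℕ := fun o => o.elim ∅ (fun p => {k | B p.1 p.2 k = true})
    obtain ⟨e, he⟩ := exists_surjective_nat (Option (Σ j, Fin (n j)))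
    obtain ⟨A, hAI, hAC⟩ := finbw_sets h (fun i => C (e i))
    have hAC' : ∀ o, (A \ C o).Finite ∨ (A ∩ C o).Finite := by
      intro o
      obtain ⟨i, rfl⟩ := he o
      exact hAC i
    refine hAI (hX2 A fun j => ?_)
    by_cases hex : ∃ i, (A \ C (some ⟨j, i⟩)).Finite
    · obtain ⟨i, hi⟩ := hex
      obtain ⟨b, hb⟩ := hi.bddAbove
      refine ⟨B j i, hB j i, b + 1, fun k hk hbk => ?_⟩
      by_contra hkB
      have := hb (show k ∈ A \ C (some ⟨j, i⟩) from ⟨hk, hkB⟩)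
      omega
    · exfalso
      push Not at hex
      have hfi : ∀ i, (A ∩ C (some ⟨j, i⟩)).Finite := fun i =>
        (hAC' (some ⟨j, i⟩)).resolve_left (hex i)
      apply hAI
      apply hfin
      refine ((Set.finite_Iio (m j)).union (Set.finite_iUnion hfi)).subset ?_
      intro k hk
      by_cases hkm : k < m j
      · exact Or.inl hkm
      · obtain ⟨i, hi⟩ := hBu j k (Set.mem_univ k) (not_lt.1 hkm)
        exact Or.inr (mem_iUnion.2 ⟨i, hk, hi⟩)
  · rintro ⟨J, hJ, hIJ, hJF⟩ x hx
    obtain ⟨A, hA, hl⟩ := finbw_of_fsigma hJ hJF x hx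
    exact ⟨A, fun h => hA (hIJ h), hl⟩
end
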